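/- No n-consistent Πₙ-definable extension of Robinson arithmetic Q is Π_{n+1}-deciding: if T ⊇ Q is n-consistent and its set of (Gödel numbers of) axioms is definable in ℕ by a Πₙ-formula, then there exists a Π_{n+1}-sentence γ with T ⊬ γ and T ⊬ ¬γ. -/

import Mathlib

/-!
Formalization of results from "Gödel–Rosser's Incompleteness Theorems for
non-RE Theories" (Salehi & Seraji).

We work in the first-order language of arithmetic `{0, S, +, ×, ≤}` with the
standard model `ℕ`.  Provability `T ⊢ φ` is rendered as the semantic
consequence `T ⊨ᵇ φ` of Mathlib's model theory library, which by the Gödel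
completeness theorem coincides with provability in first-order logic.
-/

open FirstOrder Language BoundedFormula

namespace GRNonRE

/-- Function symbols of arithmetic: `0`, `S`, `+`, `×`. -/
inductive ArithFunc : ℕ → Type
  | zero : ArithFunc 0
  | succ : ArithFunc 1
  | add  : ArithFunc 2
  | mul  : ArithFunc 2

/-- The relation symbol `≤`. -/
inductive ArithRel : ℕ → Type
  | le : ArithRel 2

/-- The first-order language of arithmetic `{0, S, +, ×, ≤}`. -/
def LA : FirstOrder.Language := ⟨ArithFunc, ArithRel⟩

/-- The standard model `ℕ`. -/
instance : LA.Structure ℕ where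
  funMap {_} f := match f with
    | ArithFunc.zero => fun _ => 0
    | ArithFunc.succ => fun v => v 0 + 1
    | ArithFunc.add  => fun v => v 0 + v 1
    | ArithFunc.mul  => fun v => v 0 * v 1
  RelMap {_} r := match r with
    | ArithRel.le => fun v => v 0 ≤ v 1

def zeroT {α : Type} : LA.Term α := Term.func ArithFunc.zero ![]
def succT {α : Type} (t : LA.Term α) : LA.Term α := Term.func ArithFunc.succ ![t]
def addT {α : Type} (t s : LA.Term α) : LA.Term α := Term.func ArithFunc.add ![t, s]
def mulT {α : Type} (t s : LA.Term α) : LA.Term α := Term.func ArithFunc.mul ![t, s]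

/-- The atomic formula `t ≤ s`. -/
def leF {α : Type} {n : ℕ} (t s : LA.Term (α ⊕ Fin n)) : LA.BoundedFormula α n :=
  BoundedFormula.rel ArithRel.le ![t, s]

/-- The numeral `m̄ = S (S ⋯ (S 0))` representing `m : ℕ`. -/
def numeral : ℕ → LA.Term Empty
  | 0 => zeroT
  | n + 1 => succT (numeral n)

instance : Encodable (Σ n, LA.Functions n) :=
  ⟨fun f => match f with
    | ⟨_, ArithFunc.zero⟩ => 0
    | ⟨_, ArithFunc.succ⟩ => 1
    | ⟨_, ArithFunc.add⟩ => 2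
    | ⟨_, ArithFunc.mul⟩ => 3,
   fun n => match n with
    | 0 => some ⟨0, ArithFunc.zero⟩
    | 1 => some ⟨1, ArithFunc.succ⟩
    | 2 => some ⟨2, ArithFunc.add⟩
    | 3 => some ⟨2, ArithFunc.mul⟩
    | _ => none,
   by rintro ⟨n, f⟩; cases f <;> rfl⟩

instance : Encodable (Σ n, LA.Relations n) :=
  ⟨fun _ => 0,
   fun n => match n with
    | 0 => some ⟨2, ArithRel.le⟩
    | _ => none,
   by rintro ⟨n, r⟩; cases r; rfl⟩

/-- A standard Gödel numbering of formulas, obtained from Mathlib's structural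
encoding of bounded formulas as lists of symbols. -/
def godel {k : ℕ} (φ : LA.BoundedFormula Empty k) : ℕ :=
  Encodable.encode φ.listEncode

/-- Lift a term in context `k` to context `k + 1`. -/
def liftT {k : ℕ} (t : LA.Term (Empty ⊕ Fin k)) : LA.Term (Empty ⊕ Fin (k + 1)) :=
  t.relabel (Sum.map id Fin.castSucc)

/-- The class `Σ₀ = Π₀ = Δ₀` of bounded formulas: built from atomic formulas by
Boolean connectives (`⊥` and `⟹`, from which `∼`, `⊓`, `⊔` are definable) and
bounded universal quantification `∀ x ≤ t, φ` (bounded existential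
quantification `∃ x ≤ t, φ` is expressible as `∼ ∀ x ≤ t, ∼φ`). -/
inductive Delta0 : ∀ {k : ℕ}, LA.BoundedFormula Empty k → Prop
  | falsum {k : ℕ} : Delta0 (⊥ : LA.BoundedFormula Empty k)
  | equal {k : ℕ} (t₁ t₂ : LA.Term (Empty ⊕ Fin k)) : Delta0 (t₁ =' t₂)
  | le {k : ℕ} (t₁ t₂ : LA.Term (Empty ⊕ Fin k)) : Delta0 (leF t₁ t₂)
  | imp {k : ℕ} {φ ψ : LA.BoundedFormula Empty k} :
      Delta0 φ → Delta0 ψ → Delta0 (φ ⟹ ψ)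
  | bdall {k : ℕ} (t : LA.Term (Empty ⊕ Fin k)) {φ : LA.BoundedFormula Empty (k + 1)} :
      Delta0 φ → Delta0 ((leF (&(Fin.last k)) (liftT t) ⟹ φ).all)

mutual
  /-- The classes `Σₙ` of the arithmetical hierarchy: `Σ₀` is the class of
  bounded formulas, and `Σ_{n+1}` contains `Πₙ` and is closed under `⊓`, `⊔`,
  existential quantification and bounded universal quantification. -/
  inductive IsSigma : ℕ → ∀ {k : ℕ}, LA.BoundedFormula Empty k → Prop
    | ofDelta0 {k : ℕ} {φ : LA.BoundedFormula Empty k} : Delta0 φ → IsSigma 0 φ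
    | ofPi {n k : ℕ} {φ : LA.BoundedFormula Empty k} :
        IsPi n φ → IsSigma (n + 1) φ
    | ex {n k : ℕ} {φ : LA.BoundedFormula Empty (k + 1)} :
        IsSigma (n + 1) φ → IsSigma (n + 1) φ.ex
    | inf {n k : ℕ} {φ ψ : LA.BoundedFormula Empty k} :
        IsSigma (n + 1) φ → IsSigma (n + 1) ψ → IsSigma (n + 1) (φ ⊓ ψ)
    | sup {n k : ℕ} {φ ψ : LA.BoundedFormula Empty k} :
        IsSigma (n + 1) φ → IsSigma (n + 1) ψ → IsSigma (n + 1) (φ ⊔ ψ)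
    | bdall {n k : ℕ} (t : LA.Term (Empty ⊕ Fin k))
        {φ : LA.BoundedFormula Empty (k + 1)} :
        IsSigma (n + 1) φ → IsSigma (n + 1) ((leF (&(Fin.last k)) (liftT t) ⟹ φ).all)

  /-- The classes `Πₙ` of the arithmetical hierarchy: `Π₀` is the class of
  bounded formulas, and `Π_{n+1}` contains `Σₙ` and is closed under `⊓`, `⊔`,
  universal quantification and bounded existential quantification. -/
  inductive IsPi : ℕ → ∀ {k : ℕ}, LA.BoundedFormula Empty k → Prop
    | ofDelta0 {k : ℕ} {φ : LA.BoundedFormula Empty k} : Delta0 φ → IsPi 0 φ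
    | ofSigma {n k : ℕ} {φ : LA.BoundedFormula Empty k} :
        IsSigma n φ → IsPi (n + 1) φ
    | all {n k : ℕ} {φ : LA.BoundedFormula Empty (k + 1)} :
        IsPi (n + 1) φ → IsPi (n + 1) φ.all
    | inf {n k : ℕ} {φ ψ : LA.BoundedFormula Empty k} :
        IsPi (n + 1) φ → IsPi (n + 1) ψ → IsPi (n + 1) (φ ⊓ ψ)
    | sup {n k : ℕ} {φ ψ : LA.BoundedFormula Empty k} :
        IsPi (n + 1) φ → IsPi (n + 1) ψ → IsPi (n + 1) (φ ⊔ ψ)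
    | bdex {n k : ℕ} (t : LA.Term (Empty ⊕ Fin k))
        {φ : LA.BoundedFormula Empty (k + 1)} :
        IsPi (n + 1) φ → IsPi (n + 1) ((leF (&(Fin.last k)) (liftT t) ⊓ φ).ex)
end

/-- `T ⊢ φ`: by the Gödel completeness theorem, provability of the sentence `φ`
from the theory `T` coincides with the semantic consequence relation. -/
def Proves (T : LA.Theory) (φ : LA.Sentence) : Prop := T ⊨ᵇ φ

/-- Consistency of a theory. -/
def Consistent (T : LA.Theory) : Prop := ¬ Proves T ⊥

/-- `ψ(m̄)`: the result of substituting the numeral `m̄` for the free variable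
of a formula `ψ(x)` with one free variable. -/
def subst1 (ψ : LA.BoundedFormula Empty 1) (m : ℕ) : LA.Sentence :=
  ψ.toFormula.subst fun _ => numeral m

/-- `n`-consistency: there is no formula `ψ(x) ∈ Π_{n-1}` such that `T ⊢ ¬ψ(m̄)`
for every numeral `m̄` (`m ∈ ℕ`) and yet `T ⊢ ∃x ψ(x)`.
(`0`-consistency is ordinary consistency.) -/
def NCon : ℕ → LA.Theory → Prop
  | 0, T => Consistent T
  | n + 1, T => ¬ ∃ ψ : LA.BoundedFormula Empty 1, IsPi n ψ ∧
      (∀ m : ℕ, Proves T (∼(subst1 ψ m))) ∧ Proves T ψ.ex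

/-- The axioms of Robinson arithmetic `Q`:
`Sx ≠ 0`, `Sx = Sy → x = y`, `x ≠ 0 → ∃y x = Sy`, `x + 0 = x`,
`x + Sy = S(x + y)`, `x·0 = 0`, `x·Sy = x·y + x`, `x ≤ y ↔ ∃z z + x = y`. -/
def QTheory : LA.Theory :=
  { ∀' ∼(succT (&0) =' zeroT),
    ∀' ∀' ((succT (&0) =' succT (&1)) ⟹ (&0 =' &1)),
    ∀' (∼(&0 =' zeroT) ⟹ ∃' (&0 =' succT (&1))),
    ∀' (addT (&0) zeroT =' &0),
    ∀' ∀' (addT (&0) (succT (&1)) =' succT (addT (&0) (&1))),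
    ∀' (mulT (&0) zeroT =' zeroT),
    ∀' ∀' (mulT (&0) (succT (&1)) =' addT (mulT (&0) (&1)) (&0)),
    ((leF (&0) (&1) ⇔ ∃' (addT (&2) (&0) =' (&1)) : LA.BoundedFormula Empty 2)).alls }

/-- `T` is an extension of Robinson arithmetic `Q` (i.e. `T` proves `Q`). -/
def ExtendsQ (T : LA.Theory) : Prop := ∀ φ ∈ QTheory, Proves T φ

/-- `Πₙ-Th(ℕ)`: the set of `Πₙ`-sentences true in the standard model. -/
def PiTh (n : ℕ) : LA.Theory := {φ | IsPi n φ ∧ ℕ ⊨ φ}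

/-- Soundness: every theorem of `T` is true in `ℕ`. -/
def Sound (T : LA.Theory) : Prop := ∀ φ : LA.Sentence, Proves T φ → ℕ ⊨ φ

/-- `Σₙ`-soundness: every `Σₙ`-sentence provable in `T` is true in `ℕ`. -/
def SigmaSound (n : ℕ) (T : LA.Theory) : Prop :=
  ∀ φ : LA.Sentence, IsSigma n φ → Proves T φ → ℕ ⊨ φ

/-- A formula `Ψ(x)` with one free variable defines the set `A ⊆ ℕ` in `ℕ`. -/
def Defines (Ψ : LA.BoundedFormula Empty 1) (A : Set ℕ) : Prop :=
  ∀ m : ℕ, m ∈ A ↔ Ψ.Realize (fun e => Empty.elim e) ![m]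

/-- `A ⊆ ℕ` is definable in `ℕ` by a `Σₙ`-formula. -/
def SigmaDefinable (n : ℕ) (A : Set ℕ) : Prop := ∃ Ψ, IsSigma n Ψ ∧ Defines Ψ A

/-- `A ⊆ ℕ` is definable in `ℕ` by a `Πₙ`-formula. -/
def PiDefinable (n : ℕ) (A : Set ℕ) : Prop := ∃ Ψ, IsPi n Ψ ∧ Defines Ψ A

/-- The set of Gödel numbers of the axioms of `T`. -/
def axiomCodes (T : LA.Theory) : Set ℕ := {m | ∃ φ ∈ T, godel φ = m}

/-- The set of Gödel numbers of the theorems of `T` (its deductive closure). -/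
def theoremCodes (T : LA.Theory) : Set ℕ := {m | ∃ φ, Proves T φ ∧ godel φ = m}

/-- The extension of a substitution under one quantifier. -/
def liftSub {k l : ℕ} (σ : Fin k → LA.Term (Empty ⊕ Fin l)) :
    Fin (k + 1) → LA.Term (Empty ⊕ Fin (l + 1)) :=
  Fin.snoc (fun i => liftT (σ i)) (&(Fin.last l))

/-- Substitution of terms for the variables of a term. -/
def subT {k l : ℕ} (σ : Fin k → LA.Term (Empty ⊕ Fin l)) (t : LA.Term (Empty ⊕ Fin k)) :
    LA.Term (Empty ⊕ Fin l) :=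
  t.subst (Sum.elim Empty.elim σ)

/-- Substitution of terms for the variables of a formula. -/
def subF : ∀ {k l : ℕ}, (Fin k → LA.Term (Empty ⊕ Fin l)) → LA.BoundedFormula Empty k →
    LA.BoundedFormula Empty l
  | _, _, _, .falsum => .falsum
  | _, _, σ, .equal t s => .equal (subT σ t) (subT σ s)
  | _, _, σ, .rel R ts => .rel R fun i => subT σ (ts i)
  | _, _, σ, .imp φ ψ => .imp (subF σ φ) (subF σ ψ)
  | _, _, σ, .all φ => .all (subF (liftSub σ) φ)

section Realize

variable {M : Type} [LA.Structure M]

/-- Truth of a formula in a structure under an assignment to its variables. -/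
def Holds {k : ℕ} (φ : LA.BoundedFormula Empty k) (v : Fin k → M) : Prop :=
  φ.Realize Empty.elim v

/-- The value of a term in a structure. -/
def tval {k : ℕ} (t : LA.Term (Empty ⊕ Fin k)) (v : Fin k → M) : M :=
  t.realize (Sum.elim Empty.elim v)

@[simp] theorem tval_var {k : ℕ} (i : Fin k) (v : Fin k → M) :
    tval (Term.var (Sum.inr i)) v = v i := rfl

@[simp] theorem tval_liftT {k : ℕ} (t : LA.Term (Empty ⊕ Fin k)) (v : Fin k → M) (x : M) :
    tval (liftT t) (Fin.snoc v x : Fin (k + 1) → M) = tval t v := by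
  unfold tval liftT
  rw [Term.realize_relabel]
  congr 1
  funext i
  rcases i with i | i
  · exact i.elim
  · simp

theorem tval_subT {k l : ℕ} (σ : Fin k → LA.Term (Empty ⊕ Fin l)) (t : LA.Term (Empty ⊕ Fin k))
    (v : Fin l → M) : tval (subT σ t) v = tval t (fun i => tval (σ i) v) := by
  unfold tval subT
  rw [Term.realize_subst]
  congr 1
  funext i
  rcases i with i | i
  · exact i.elim
  · simp

theorem tval_liftSub {k l : ℕ} (σ : Fin k → LA.Term (Empty ⊕ Fin l)) (v : Fin l → M) (x : M) :
    (fun i => tval (liftSub σ i) (Fin.snoc v x : Fin (l + 1) → M)) =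
      Fin.snoc (fun i => tval (σ i) v) x := by
  funext i
  refine Fin.lastCases ?_ (fun i => ?_) i <;> simp [liftSub]

@[simp] theorem holds_equal {k : ℕ} (t s : LA.Term (Empty ⊕ Fin k)) (v : Fin k → M) :
    Holds (t =' s) v ↔ tval t v = tval s v := Iff.rfl

@[simp] theorem holds_imp {k : ℕ} (φ ψ : LA.BoundedFormula Empty k) (v : Fin k → M) :
    Holds (φ ⟹ ψ) v ↔ (Holds φ v → Holds ψ v) := Iff.rfl

@[simp] theorem holds_not {k : ℕ} (φ : LA.BoundedFormula Empty k) (v : Fin k → M) :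
    Holds (∼φ) v ↔ ¬ Holds φ v := Iff.rfl

@[simp] theorem holds_all {k : ℕ} (φ : LA.BoundedFormula Empty (k + 1)) (v : Fin k → M) :
    Holds φ.all v ↔ ∀ x, Holds φ (Fin.snoc v x : Fin (k + 1) → M) := Iff.rfl

@[simp] theorem holds_ex {k : ℕ} (φ : LA.BoundedFormula Empty (k + 1)) (v : Fin k → M) :
    Holds φ.ex v ↔ ∃ x, Holds φ (Fin.snoc v x : Fin (k + 1) → M) := realize_ex

@[simp] theorem holds_inf {k : ℕ} (φ ψ : LA.BoundedFormula Empty k) (v : Fin k → M) :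
    Holds (φ ⊓ ψ) v ↔ Holds φ v ∧ Holds ψ v := realize_inf

@[simp] theorem holds_sup {k : ℕ} (φ ψ : LA.BoundedFormula Empty k) (v : Fin k → M) :
    Holds (φ ⊔ ψ) v ↔ Holds φ v ∨ Holds ψ v := realize_sup

theorem holds_subF {k l : ℕ} (σ : Fin k → LA.Term (Empty ⊕ Fin l))
    (φ : LA.BoundedFormula Empty k) (v : Fin l → M) :
    Holds (subF σ φ) v ↔ Holds φ (fun i => tval (σ i) v) := by
  induction φ generalizing l with
  | falsum => exact Iff.rfl
  | equal t s =>
    change tval (subT σ t) v = tval (subT σ s) v ↔ _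
    rw [tval_subT, tval_subT]
    rfl
  | rel R ts =>
    change Structure.RelMap R (fun i => tval (subT σ (ts i)) v) ↔ _
    simp only [tval_subT]
    rfl
  | imp φ ψ ih₁ ih₂ => exact imp_congr (ih₁ σ v) (ih₂ σ v)
  | all φ ih =>
    refine forall_congr' fun x => (ih (liftSub σ) (Fin.snoc v x)).trans ?_
    rw [tval_liftSub]
    rfl

end Realize

theorem subT_liftT {k l : ℕ} (σ : Fin k → LA.Term (Empty ⊕ Fin l))
    (t : LA.Term (Empty ⊕ Fin k)) : subT (liftSub σ) (liftT t) = liftT (subT σ t) := by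
  unfold subT
  induction t with
  | var i =>
    rcases i with i | i
    · exact i.elim
    · simp [liftT, liftSub, Term.relabel]
  | func f ts ih =>
    simp only [liftT, Term.relabel, Term.subst] at ih ⊢
    congr 1
    funext i
    exact ih i

theorem subF_leF {k l : ℕ} (σ : Fin k → LA.Term (Empty ⊕ Fin l))
    (t s : LA.Term (Empty ⊕ Fin k)) : subF σ (leF t s) = leF (subT σ t) (subT σ s) := by
  simp only [leF, subF]
  congr 1
  funext i
  fin_cases i <;> rfl

theorem subT_liftSub_last {k l : ℕ} (σ : Fin k → LA.Term (Empty ⊕ Fin l)) :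
    subT (liftSub σ) (&(Fin.last k)) = &(Fin.last l) := by
  simp [subT, liftSub]

theorem Delta0.subF {k : ℕ} {φ : LA.BoundedFormula Empty k} (h : Delta0 φ) :
    ∀ {l : ℕ} (σ : Fin k → LA.Term (Empty ⊕ Fin l)), Delta0 (subF σ φ) := by
  induction h with
  | falsum => exact fun _ => .falsum
  | equal t s => exact fun _ => .equal _ _
  | le t s =>
    intro l σ
    rw [subF_leF]
    exact .le _ _
  | imp _ _ ih₁ ih₂ => exact fun σ => .imp (ih₁ σ) (ih₂ σ)
  | bdall t _ ih =>
    intro l σ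
    change Delta0 ((GRNonRE.subF (liftSub σ) (leF _ _) ⟹ _).all)
    rw [subF_leF, subT_liftT, subT_liftSub_last]
    exact .bdall _ (ih _)

/-- `Strict n φ φ'`: the formula `φ` is prenex `Σₙ`, with one quantifier in each block, and `φ'`
is its prenex `Πₙ` negation. -/
inductive Strict : ℕ → ∀ {k : ℕ}, LA.BoundedFormula Empty k → LA.BoundedFormula Empty k → Prop
  | zero {k : ℕ} {φ : LA.BoundedFormula Empty k} : Delta0 φ → Strict 0 φ (∼φ)
  | succ {n k : ℕ} {φ φ' : LA.BoundedFormula Empty (k + 1)} :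
      Strict n φ φ' → Strict (n + 1) φ'.ex φ.all

theorem Strict.subF {n k : ℕ} {φ φ' : LA.BoundedFormula Empty k} (h : Strict n φ φ') :
    ∀ {l : ℕ} (σ : Fin k → LA.Term (Empty ⊕ Fin l)), Strict n (subF σ φ) (subF σ φ') := by
  induction h with
  | zero h => exact fun σ => .zero (h.subF σ)
  | succ _ ih => exact fun σ => .succ (ih (liftSub σ))

theorem Strict.holds_neg {n k : ℕ} {φ φ' : LA.BoundedFormula Empty k} (h : Strict n φ φ')
    {M : Type} [LA.Structure M] (v : Fin k → M) : Holds φ' v ↔ ¬ Holds φ v := by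
  induction h with
  | zero h => rfl
  | succ _ ih => simp [ih]

theorem Strict.classes {n k : ℕ} {φ φ' : LA.BoundedFormula Empty k} (h : Strict n φ φ') (m : ℕ) :
    IsSigma (n + m) φ ∧ IsPi (n + m) φ' ∧ IsSigma (n + m + 1) φ' ∧ IsPi (n + m + 1) φ := by
  induction h with
  | @zero k φ h =>
    have key : ∀ {ψ : LA.BoundedFormula Empty k}, Delta0 ψ → ∀ m, IsSigma m ψ ∧ IsPi m ψ := by
      intro ψ hψ m
      induction m with
      | zero => exact ⟨.ofDelta0 hψ, .ofDelta0 hψ⟩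
      | succ m ih => exact ⟨.ofPi ih.2, .ofSigma ih.1⟩
    have hn : Delta0 (∼φ) := .imp h .falsum
    exact ⟨(key h _).1, (key hn _).2, (key hn _).1, (key h _).2⟩
  | @succ n k φ φ' _ ih =>
    rw [Nat.add_right_comm n 1 m]
    obtain ⟨h₁, h₂, h₃, h₄⟩ := ih
    have h₅ := IsSigma.ex (IsSigma.ofPi h₂)
    have h₆ := IsPi.all (IsPi.ofSigma h₁)
    exact ⟨h₅, h₆, .ofPi h₆, .ofSigma h₅⟩

theorem Strict.isPi {n m k : ℕ} {φ φ' : LA.BoundedFormula Empty k} (h : Strict n φ φ')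
    (hm : n ≤ m) : IsPi m φ' := by
  obtain ⟨d, rfl⟩ := Nat.exists_eq_add_of_le hm
  exact (h.classes d).2.1

theorem holds_leF {k : ℕ} (t s : LA.Term (Empty ⊕ Fin k)) (v : Fin k → ℕ) :
    Holds (leF t s) v ↔ tval t v ≤ tval s v := Iff.rfl

/-- `SD n R`: the relation `R` on `ℕ` is `Σₙ`, in prenex form with one quantifier per block. -/
def SD : ℕ → ∀ {k : ℕ}, ((Fin k → ℕ) → Prop) → Prop
  | 0, _, R => ∃ φ, Delta0 φ ∧ ∀ v, R v ↔ Holds φ v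
  | n + 1, k, R => ∃ S : (Fin (k + 1) → ℕ) → Prop, SD n S ∧
      ∀ v, R v ↔ ∃ y, ¬ S (Fin.snoc v y : Fin (k + 1) → ℕ)

theorem SD.strict {n k : ℕ} {R : (Fin k → ℕ) → Prop} (h : SD n R) :
    ∃ φ φ', Strict n φ φ' ∧ ∀ v, R v ↔ Holds φ v := by
  induction n generalizing k with
  | zero =>
    obtain ⟨φ, h₁, h₂⟩ := h
    exact ⟨φ, _, .zero h₁, h₂⟩
  | succ n ih =>
    obtain ⟨S, hS, hR⟩ := h
    obtain ⟨φ, φ', h₁, h₂⟩ := ih hS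
    exact ⟨_, _, .succ h₁, fun v => by simp [hR, h₁.holds_neg, h₂]⟩

theorem SD.congr {n k : ℕ} {R S : (Fin k → ℕ) → Prop} (h : SD n R) (H : ∀ v, S v ↔ R v) :
    SD n S := by
  rwa [show S = R from funext fun v => propext (H v)]

theorem SD.subst {n k l : ℕ} {R : (Fin k → ℕ) → Prop} (h : SD n R)
    (σ : Fin k → LA.Term (Empty ⊕ Fin l)) : SD n fun v => R fun i => tval (σ i) v := by
  induction n generalizing k l with
  | zero =>
    obtain ⟨φ, h₁, h₂⟩ := h
    exact ⟨_, h₁.subF σ, fun v => (h₂ _).trans (holds_subF σ φ v).symm⟩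
  | succ n ih =>
    obtain ⟨S, hS, hR⟩ := h
    refine ⟨_, ih hS (liftSub σ), fun v => (hR _).trans ?_⟩
    simp only [tval_liftSub]

theorem SD.proj {n k l : ℕ} {R : (Fin k → ℕ) → Prop} (h : SD n R) (f : Fin k → Fin l) :
    SD n fun v => R fun i => v (f i) :=
  h.subst fun i => &(f i)

theorem SD.not_zero {k : ℕ} {R : (Fin k → ℕ) → Prop} (h : SD 0 R) : SD 0 fun v => ¬ R v := by
  obtain ⟨φ, h₁, h₂⟩ := h
  exact ⟨_, h₁.imp .falsum, fun v => not_congr (h₂ v)⟩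

theorem SD.not {n k : ℕ} {R : (Fin k → ℕ) → Prop} (h : SD n R) : SD (n + 1) fun v => ¬ R v :=
  ⟨_, h.proj Fin.castSucc, fun v => by simp⟩

theorem SD.succ {n k : ℕ} {R : (Fin k → ℕ) → Prop} (h : SD n R) : SD (n + 1) R := by
  induction n generalizing k with
  | zero => exact h.not_zero.not.congr fun v => by simp
  | succ n ih =>
    obtain ⟨S, hS, hR⟩ := h
    exact ⟨S, ih hS, hR⟩

theorem SD.mono {n m k : ℕ} {R : (Fin k → ℕ) → Prop} (h : SD n R) (hm : n ≤ m) : SD m R := by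
  induction hm with
  | refl => exact h
  | step _ ih => exact ih.succ

theorem SD.exists_bound_forall {k : ℕ} (t : LA.Term (Empty ⊕ Fin k))
    (S : (Fin (k + 2) → ℕ) → Prop) (v : Fin k → ℕ) :
    (∀ x ≤ tval t v, ∃ y, S (Fin.snoc (Fin.snoc v x : Fin (k + 1) → ℕ) y)) ↔
      ∃ w, ∀ x ≤ tval t v, ∃ y ≤ w, S (Fin.snoc (Fin.snoc v x : Fin (k + 1) → ℕ) y) := by
  constructor
  · intro h
    choose! f hf using h
    exact ⟨(Finset.range (tval t v + 1)).sup f, fun x hx =>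
      ⟨f x, Finset.le_sup (Finset.mem_range.2 (Nat.lt_succ_of_le hx)), hf x hx⟩⟩
  · rintro ⟨w, h⟩ x hx
    obtain ⟨y, -, hy⟩ := h x hx
    exact ⟨y, hy⟩

/-- Inserting a fresh variable just below the last `1` variables. -/
def skipOne (k : ℕ) : Fin (k + 1) → Fin (k + 2) :=
  Fin.snoc (fun i => i.castSucc.castSucc) (Fin.last _)

/-- Inserting a fresh variable just below the last `2` variables. -/
def skipTwo (k : ℕ) : Fin (k + 2) → Fin (k + 3) :=
  Fin.snoc (Fin.snoc (fun i => i.castSucc.castSucc.castSucc) (Fin.last _).castSucc) (Fin.last _)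

theorem snoc_comp_skipOne {k : ℕ} (v : Fin k → ℕ) (w x : ℕ) :
    (fun i => (Fin.snoc (Fin.snoc v w : Fin (k + 1) → ℕ) x : Fin (k + 2) → ℕ) (skipOne k i)) =
      Fin.snoc v x := by
  funext i
  refine Fin.lastCases ?_ (fun i => ?_) i <;> simp [skipOne]

theorem snoc_comp_skipTwo {k : ℕ} (v : Fin k → ℕ) (w x y : ℕ) :
    (fun i => (Fin.snoc (Fin.snoc (Fin.snoc v w : Fin (k + 1) → ℕ) x : Fin (k + 2) → ℕ) y :
      Fin (k + 3) → ℕ) (skipTwo k i)) = Fin.snoc (Fin.snoc v x : Fin (k + 1) → ℕ) y := by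
  funext i
  refine Fin.lastCases ?_ (fun i => Fin.lastCases ?_ (fun i => ?_) i) i <;> simp [skipTwo]

/-- The closure properties shared by all levels of the hierarchy. -/
structure ClosedLevel (n : ℕ) : Prop where
  and {k : ℕ} {R S : (Fin k → ℕ) → Prop} : SD n R → SD n S → SD n fun v => R v ∧ S v
  or {k : ℕ} {R S : (Fin k → ℕ) → Prop} : SD n R → SD n S → SD n fun v => R v ∨ S v
  bdall {k : ℕ} (t : LA.Term (Empty ⊕ Fin k)) {R : (Fin (k + 1) → ℕ) → Prop} :
    SD n R → SD n fun v => ∀ x ≤ tval t v, R (Fin.snoc v x : Fin (k + 1) → ℕ)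
  bdex {k : ℕ} (t : LA.Term (Empty ⊕ Fin k)) {R : (Fin (k + 1) → ℕ) → Prop} :
    SD n R → SD n fun v => ∃ x ≤ tval t v, R (Fin.snoc v x : Fin (k + 1) → ℕ)

theorem closedLevel_zero : ClosedLevel 0 := by
  have hor : ∀ {k : ℕ} {R S : (Fin k → ℕ) → Prop}, SD 0 R → SD 0 S →
      SD 0 fun v => R v ∨ S v := by
    rintro k R S hR ⟨ψ, h₃, h₄⟩
    obtain ⟨φ, h₁, h₂⟩ := hR.not_zero
    refine ⟨_, h₁.imp h₃, fun v => ?_⟩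
    rw [holds_imp, ← h₂, ← h₄]
    tauto
  have hall : ∀ {k : ℕ} (t : LA.Term (Empty ⊕ Fin k)) {R : (Fin (k + 1) → ℕ) → Prop},
      SD 0 R → SD 0 fun v => ∀ x ≤ tval t v, R (Fin.snoc v x : Fin (k + 1) → ℕ) := by
    rintro k t R ⟨φ, h₁, h₂⟩
    refine ⟨_, h₁.bdall t, fun v => ?_⟩
    simp [h₂, holds_leF]
  exact
    { or := hor
      and := fun hR hS => (hor hR.not_zero hS.not_zero).not_zero.congr fun v => by tauto
      bdall := hall
      bdex := fun t _ hR => (hall t hR.not_zero).not_zero.congr fun v => by push Not; rfl }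

theorem ClosedLevel.succ {n : ℕ} (C : ClosedLevel n) : ClosedLevel (n + 1) where
  and := by
    rintro k R₁ R₂ ⟨S₁, h₁, e₁⟩ ⟨S₂, h₂, e₂⟩
    refine ⟨_, C.or (C.bdall (&(Fin.last k)) (h₁.proj (skipOne k)))
      (C.bdall (&(Fin.last k)) (h₂.proj (skipOne k))), fun v => ?_⟩
    simp only [e₁, e₂, snoc_comp_skipOne, Function.comp_apply, tval_var, Fin.snoc_last, not_or,
      not_forall]
    constructor
    · rintro ⟨⟨y, hy⟩, ⟨z, hz⟩⟩
      exact ⟨max y z, ⟨y, le_max_left _ _, hy⟩, ⟨z, le_max_right _ _, hz⟩⟩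
    · rintro ⟨w, ⟨y, -, hy⟩, ⟨z, -, hz⟩⟩
      exact ⟨⟨y, hy⟩, ⟨z, hz⟩⟩
  or := by
    rintro k R₁ R₂ ⟨S₁, h₁, e₁⟩ ⟨S₂, h₂, e₂⟩
    refine ⟨_, C.and h₁ h₂, fun v => ?_⟩
    simp only [e₁, e₂, not_and_or, exists_or]
  bdall := by
    rintro k t R ⟨S, h, e⟩
    refine ⟨_, C.bdex (liftT t) (C.bdall (&(Fin.last k).castSucc) (h.proj (skipTwo k))),
      fun v => ?_⟩
    simp only [e, snoc_comp_skipTwo, Function.comp_apply, tval_var, Fin.snoc_last, tval_liftT,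
      Fin.snoc_castSucc]
    rw [SD.exists_bound_forall t fun u => ¬ S u]
    push Not
    rfl
  bdex := by
    rintro k t R ⟨S, h, e⟩
    refine ⟨_, C.bdall (liftT t) (C.bdall (&(Fin.last k).castSucc) (h.proj (skipTwo k))),
      fun v => ?_⟩
    simp only [e, snoc_comp_skipTwo, Function.comp_apply, tval_var, Fin.snoc_last, tval_liftT,
      Fin.snoc_castSucc]
    push Not
    constructor
    · rintro ⟨x, hx, y, hy⟩
      exact ⟨y, x, hx, y, le_rfl, hy⟩
    · rintro ⟨_, x, hx, y, -, hy⟩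
      exact ⟨x, hx, y, hy⟩

theorem closedLevel (n : ℕ) : ClosedLevel n := by
  induction n with
  | zero => exact closedLevel_zero
  | succ n ih => exact ih.succ

theorem SD.and {n k : ℕ} {R S : (Fin k → ℕ) → Prop} (hR : SD n R) (hS : SD n S) :
    SD n fun v => R v ∧ S v := (closedLevel n).and hR hS

theorem SD.or {n k : ℕ} {R S : (Fin k → ℕ) → Prop} (hR : SD n R) (hS : SD n S) :
    SD n fun v => R v ∨ S v := (closedLevel n).or hR hS

theorem SD.ex {n k : ℕ} {R : (Fin (k + 1) → ℕ) → Prop} (hR : SD (n + 1) R) :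
    SD (n + 1) fun v => ∃ x, R (Fin.snoc v x : Fin (k + 1) → ℕ) := by
  obtain ⟨S, h, e⟩ := hR
  have C := closedLevel n
  refine ⟨_, C.bdall (&(Fin.last k)) (C.bdall (&(Fin.last k).castSucc) (h.proj (skipTwo k))),
      fun v => ?_⟩
  simp only [e, snoc_comp_skipTwo, Function.comp_apply, tval_var, Fin.snoc_last, Fin.snoc_castSucc]
  push Not
  constructor
  · rintro ⟨x, y, hy⟩
    exact ⟨max x y, x, le_max_left _ _, y, le_max_right _ _, hy⟩
  · rintro ⟨_, x, -, y, -, hy⟩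
    exact ⟨x, y, hy⟩

theorem SD.exists {n k : ℕ} {R : (Fin k → ℕ) → ℕ → Prop}
    (hR : SD (n + 1) fun v : Fin (k + 1) → ℕ => R (fun i => v i.castSucc) (v (Fin.last k))) :
    SD (n + 1) fun v => ∃ x, R v x :=
  hR.ex.congr fun v => by simp

theorem SD.forall_le {n k : ℕ} {R : (Fin k → ℕ) → ℕ → Prop} (i : Fin k)
    (hR : SD n fun v : Fin (k + 1) → ℕ => R (fun i => v i.castSucc) (v (Fin.last k))) :
    SD n fun v => ∀ x ≤ v i, R v x :=
  ((closedLevel n).bdall (&i) hR).congr fun v => by simp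

theorem SD.equal {k : ℕ} (n : ℕ) (t s : LA.Term (Empty ⊕ Fin k)) :
    SD n fun v => tval t v = tval s v :=
  SD.mono (n := 0) ⟨_, .equal t s, fun _ => Iff.rfl⟩ (Nat.zero_le n)

theorem SD.le {k : ℕ} (n : ℕ) (t s : LA.Term (Empty ⊕ Fin k)) :
    SD n fun v => tval t v ≤ tval s v :=
  SD.mono (n := 0) ⟨_, .le t s, fun _ => Iff.rfl⟩ (Nat.zero_le n)

mutual

theorem IsSigma.sd : ∀ {n k : ℕ} {φ : LA.BoundedFormula Empty k}, IsSigma n φ →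
    SD n fun v : Fin k → ℕ => Holds φ v
  | _, _, _, .ofDelta0 h => ⟨_, h, fun _ => Iff.rfl⟩
  | _, _, _, .ofPi h => h.sd.not.congr fun v => by simp
  | _, _, _, .ex h => h.sd.ex.congr fun v => by simp
  | _, _, _, .inf h₁ h₂ => (h₁.sd.and h₂.sd).congr fun v => by simp
  | _, _, _, .sup h₁ h₂ => (h₁.sd.or h₂.sd).congr fun v => by simp
  | _, _, _, .bdall t h => ((closedLevel _).bdall t h.sd).congr fun v => by simp [holds_leF]

theorem IsPi.sd : ∀ {n k : ℕ} {φ : LA.BoundedFormula Empty k}, IsPi n φ →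
    SD n fun v : Fin k → ℕ => ¬ Holds φ v
  | _, _, _, .ofDelta0 h => SD.not_zero ⟨_, h, fun _ => Iff.rfl⟩
  | _, _, _, .ofSigma h => h.sd.not
  | _, _, _, .all h => h.sd.ex.congr fun v => by simp
  | _, _, _, .inf h₁ h₂ => (h₁.sd.or h₂.sd).congr fun v => by simp [imp_iff_not_or]
  | _, _, _, .sup h₁ h₂ => (h₁.sd.and h₂.sd).congr fun v => by simp
  | _, _, _, .bdex t h => ((closedLevel _).bdall t h.sd).congr fun v => by simp [holds_leF]

end

theorem tval_addT {k : ℕ} (t s : LA.Term (Empty ⊕ Fin k)) (v : Fin k → ℕ) :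
    tval (addT t s) v = tval t v + tval s v := rfl

theorem tval_mulT {k : ℕ} (t s : LA.Term (Empty ⊕ Fin k)) (v : Fin k → ℕ) :
    tval (mulT t s) v = tval t v * tval s v := rfl

theorem tval_succT {k : ℕ} (t : LA.Term (Empty ⊕ Fin k)) (v : Fin k → ℕ) :
    tval (succT t) v = tval t v + 1 := rfl

theorem SD.proj₃ {n l : ℕ} {P : ℕ → ℕ → ℕ → Prop}
    (h : SD n fun v : Fin 3 → ℕ => P (v 0) (v 1) (v 2)) (a b c : Fin l) :
    SD n fun v => P (v a) (v b) (v c) :=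
  h.proj ![a, b, c]

theorem SD.proj₄ {n l : ℕ} {P : ℕ → ℕ → ℕ → ℕ → Prop}
    (h : SD n fun v : Fin 4 → ℕ => P (v 0) (v 1) (v 2) (v 3)) (a b c d : Fin l) :
    SD n fun v => P (v a) (v b) (v c) (v d) :=
  h.proj ![a, b, c, d]

theorem SD.pair {l : ℕ} (n : ℕ) (a b c : Fin l) :
    SD n fun v => Nat.pair (v a) (v b) = v c := by
  refine SD.proj₃ (P := fun x y z => Nat.pair x y = z) ?_ a b c
  have h₁ := (SD.le (k := 3) n (succT (&0)) (&1)).and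
    (SD.equal n (addT (mulT (&1) (&1)) (&0)) (&2))
  have h₂ := (SD.le (k := 3) n (&1) (&0)).and
    (SD.equal n (addT (addT (mulT (&0) (&0)) (&0)) (&1)) (&2))
  refine (h₁.or h₂).congr fun v => ?_
  simp only [tval_addT, tval_mulT, tval_succT, Function.comp_apply, tval_var, Nat.pair]
  split <;> omega

theorem SD.mod {l : ℕ} (a b c d : Fin l) :
    SD 1 fun v => v a % ((v c + 1) * v b + 1) = v d := by
  refine SD.proj₄ (P := fun s t i r => s % ((i + 1) * t + 1) = r) ?_ a b c d
  have h₁ := SD.equal (k := 5) 1 (&0)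
    (addT (mulT (&4) (succT (mulT (succT (&2)) (&1)))) (&3))
  have h₂ := SD.le (k := 5) 1 (succT (&3)) (succT (mulT (succT (&2)) (&1)))
  refine (h₁.and h₂).ex.congr fun v => ?_
  simp only [tval_addT, tval_mulT, tval_succT, Function.comp_apply, tval_var]
  change _ ↔ ∃ x, v 0 = x * ((v 2 + 1) * v 1 + 1) + v 3 ∧ v 3 + 1 ≤ (v 2 + 1) * v 1 + 1
  constructor
  · intro h
    refine ⟨v 0 / ((v 2 + 1) * v 1 + 1), ?_, ?_⟩
    · rw [← h, Nat.div_add_mod']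
    · rw [← h]
      exact Nat.mod_lt _ (Nat.succ_pos _)
  · rintro ⟨x, h₁, h₂⟩
    rw [h₁, Nat.mul_add_mod_self_right]
    exact Nat.mod_eq_of_lt h₂

/-- The graph of the unary function `f` is `Σ₁`. -/
def SDGraph (f : ℕ → ℕ) : Prop := SD 1 fun v : Fin 2 → ℕ => f (v 0) = v 1

theorem SDGraph.app {f : ℕ → ℕ} (h : SDGraph f) {l : ℕ} (a b : Fin l) :
    SD 1 fun v => f (v a) = v b :=
  h.proj ![a, b]

theorem natRec_eq_iff_beta (a : ℕ) (g : ℕ → ℕ → ℕ) (n y : ℕ) :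
    (Nat.rec a g n : ℕ) = y ↔ ∃ s t, s % ((0 + 1) * t + 1) = a ∧ s % ((n + 1) * t + 1) = y ∧
      ∀ i ≤ n, i = n ∨ s % ((i + 1 + 1) * t + 1) = g i (s % ((i + 1) * t + 1)) := by
  constructor
  · rintro rfl
    set l : List ℕ := (List.range (n + 1)).map fun i => (Nat.rec a g i : ℕ) with hl
    have key : ∀ i ≤ n, (Nat.unbeta l).unpair.1 % ((i + 1) * (Nat.unbeta l).unpair.2 + 1) =
        (Nat.rec a g i : ℕ) := by
      intro i hi
      have hlen : i < l.length := by simp [hl]; omega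
      have := Nat.beta_unbeta_coe l ⟨i, hlen⟩
      simpa [hl, Nat.beta] using this
    refine ⟨(Nat.unbeta l).unpair.1, (Nat.unbeta l).unpair.2, key 0 (Nat.zero_le _),
      key n le_rfl, fun i hi => ?_⟩
    rcases hi.eq_or_lt with h | h
    · exact Or.inl h
    · right
      rw [key i hi, key (i + 1) h]
  · rintro ⟨s, t, h₀, hn, h⟩
    have key : ∀ i ≤ n, s % ((i + 1) * t + 1) = (Nat.rec a g i : ℕ) := by
      intro i
      induction i with
      | zero => exact fun _ => h₀
      | succ i ih =>
        intro hi
        rcases h i (by omega) with h' | h'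
        · omega
        · rw [h', ih (by omega)]
    rw [← hn, key n le_rfl]

theorem sdGraph_of_primrec {f : ℕ → ℕ} (hf : Nat.Primrec f) : SDGraph f := by
  induction hf with
  | zero => exact (SD.equal (k := 2) 1 zeroT (&1)).congr fun v => Iff.rfl
  | succ => exact (SD.equal (k := 2) 1 (succT (&0)) (&1)).congr fun v => Iff.rfl
  | left =>
    refine (SD.exists (SD.pair (l := 3) 1 1 2 0)).congr
      (R := fun v => ∃ y, Nat.pair (v 1) y = v 0) fun v => ?_
    constructor
    · intro h
      exact ⟨(v 0).unpair.2, by rw [← h, Nat.pair_unpair]⟩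
    · rintro ⟨y, h⟩
      change (Nat.unpair (v 0)).1 = v 1
      rw [← h, Nat.unpair_pair]
  | right =>
    refine (SD.exists (SD.pair (l := 3) 1 2 1 0)).congr
      (R := fun v => ∃ y, Nat.pair y (v 1) = v 0) fun v => ?_
    constructor
    · intro h
      exact ⟨(v 0).unpair.1, by rw [← h, Nat.pair_unpair]⟩
    · rintro ⟨y, h⟩
      change (Nat.unpair (v 0)).2 = v 1
      rw [← h, Nat.unpair_pair]
  | @pair f g _ _ hf hg =>
    refine SD.congr (R := fun v => ∃ y z, f (v 0) = y ∧ g (v 0) = z ∧ Nat.pair y z = v 1) ?_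
      fun v => by simp
    refine SD.exists (SD.exists ?_)
    exact (hf.app _ _).and ((hg.app _ _).and (SD.pair _ _ _ _))
  | @comp f g _ _ hf hg =>
    refine SD.congr (R := fun v => ∃ y, g (v 0) = y ∧ f y = v 1) ?_ fun v => by simp
    exact SD.exists ((hg.app _ _).and (hf.app _ _))
  | @prec f g _ _ hf hg =>
    refine SD.congr (R := fun v => ∃ z n s t w o, Nat.pair z n = v 0 ∧ o = 0 ∧ f z = w ∧
        s % ((o + 1) * t + 1) = w ∧ s % ((n + 1) * t + 1) = v 1 ∧
        ∀ i ≤ n, i = n ∨ ∃ u p q r j, s % ((i + 1) * t + 1) = u ∧ Nat.pair i u = p ∧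
          Nat.pair z p = q ∧ g q = r ∧ j = i + 1 ∧ s % ((j + 1) * t + 1) = r) ?_ fun v => ?_
    · refine SD.exists (SD.exists (SD.exists (SD.exists (SD.exists (SD.exists ?_)))))
      refine (SD.pair _ _ _ _).and ((SD.equal _ (&_) zeroT).and ((hf.app _ _).and
        ((SD.mod _ _ _ _).and ((SD.mod _ _ _ _).and (SD.forall_le _
          ((SD.equal _ (&_) (&_)).or ?_))))))
      refine SD.exists (SD.exists (SD.exists (SD.exists (SD.exists ?_))))
      exact (SD.mod _ _ _ _).and ((SD.pair _ _ _ _).and ((SD.pair _ _ _ _).and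
        ((hg.app _ _).and ((SD.equal _ (&_) (succT (&_))).and (SD.mod _ _ _ _)))))
    · simp only [Nat.unpaired, natRec_eq_iff_beta]
      constructor
      · rintro ⟨s, t, h₀, h₁, h₂⟩
        refine ⟨(v 0).unpair.1, (v 0).unpair.2, s, t, _, 0, Nat.pair_unpair _, rfl, rfl, h₀, h₁,
          fun i hi => (h₂ i hi).imp_right fun h => ?_⟩
        exact ⟨_, _, _, _, _, rfl, rfl, rfl, rfl, rfl, h⟩
      · rintro ⟨z, n, s, t, w, o, hz, rfl, rfl, h₀, h₁, h₂⟩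
        rw [← hz, Nat.unpair_pair]
        refine ⟨s, t, h₀, h₁, fun i hi => (h₂ i hi).imp_right ?_⟩
        rintro ⟨_, _, _, _, _, rfl, rfl, rfl, rfl, rfl, h⟩
        exact h

theorem SD.of_primrec {l : ℕ} {P : ℕ × ℕ × ℕ → Prop} (hP : PrimrecPred P) (a b c : Fin l) :
    SD 1 fun v => P (v a, v b, v c) := by
  classical
  have h₁ : Nat.Primrec fun x => if P (x.unpair.1, x.unpair.2.unpair.1, x.unpair.2.unpair.2)
      then 1 else 0 := by
    refine Primrec.nat_iff.1 (Primrec.ite (hP.comp ?_) (Primrec.const 1) (Primrec.const 0))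
    have h := Primrec.unpair
    exact (Primrec.fst.comp h).pair (h.comp (Primrec.snd.comp h))
  have h₂ := sdGraph_of_primrec h₁
  refine SD.congr (R := fun v => ∃ x y o, Nat.pair (v b) (v c) = x ∧ Nat.pair (v a) x = y ∧
    o = 1 ∧ (if P (y.unpair.1, y.unpair.2.unpair.1, y.unpair.2.unpair.2) then 1 else 0) = o) ?_
    fun v => by simp
  refine SD.exists (SD.exists (SD.exists ?_))
  exact (SD.pair _ _ _ _).and ((SD.pair _ _ _ _).and
    ((SD.equal _ (&_) (succT zeroT)).and (h₂.app _ _)))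

section Operations

variable {M : Type} [LA.Structure M]

/-- The interpretation of `0`. -/
def zeroM : M := Structure.funMap (L := LA) ArithFunc.zero ![]

/-- The interpretation of `S`. -/
def succM (a : M) : M := Structure.funMap (L := LA) ArithFunc.succ ![a]

/-- The interpretation of `+`. -/
def addM (a b : M) : M := Structure.funMap (L := LA) ArithFunc.add ![a, b]

/-- The interpretation of `×`. -/
def mulM (a b : M) : M := Structure.funMap (L := LA) ArithFunc.mul ![a, b]

/-- The interpretation of `≤`. -/
def leM (a b : M) : Prop := Structure.RelMap (L := LA) ArithRel.le ![a, b]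

theorem tval_func_zero {k : ℕ} (ts : Fin 0 → LA.Term (Empty ⊕ Fin k)) (v : Fin k → M) :
    tval (Term.func (L := LA) ArithFunc.zero ts) v = zeroM :=
  congrArg (Structure.funMap (L := LA) ArithFunc.zero) (Subsingleton.elim _ _)

theorem tval_func_succ {k : ℕ} (ts : Fin 1 → LA.Term (Empty ⊕ Fin k)) (v : Fin k → M) :
    tval (Term.func (L := LA) ArithFunc.succ ts) v = succM (tval (ts 0) v) :=
  congrArg (Structure.funMap (L := LA) ArithFunc.succ) (List.ofFn_inj.1 rfl)

theorem tval_func_add {k : ℕ} (ts : Fin 2 → LA.Term (Empty ⊕ Fin k)) (v : Fin k → M) :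
    tval (Term.func (L := LA) ArithFunc.add ts) v = addM (tval (ts 0) v) (tval (ts 1) v) :=
  congrArg (Structure.funMap (L := LA) ArithFunc.add) (List.ofFn_inj.1 rfl)

theorem tval_func_mul {k : ℕ} (ts : Fin 2 → LA.Term (Empty ⊕ Fin k)) (v : Fin k → M) :
    tval (Term.func (L := LA) ArithFunc.mul ts) v = mulM (tval (ts 0) v) (tval (ts 1) v) :=
  congrArg (Structure.funMap (L := LA) ArithFunc.mul) (List.ofFn_inj.1 rfl)

theorem holds_rel {k : ℕ} (ts : Fin 2 → LA.Term (Empty ⊕ Fin k)) (v : Fin k → M) :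
    Holds (BoundedFormula.rel (L := LA) ArithRel.le ts) v ↔
      leM (tval (ts 0) v) (tval (ts 1) v) := by
  have : (fun i => tval (ts i) v) = ![tval (ts 0) v, tval (ts 1) v] := List.ofFn_inj.1 rfl
  unfold leM
  rw [← this]
  rfl

theorem holds_leF_iff {k : ℕ} (t s : LA.Term (Empty ⊕ Fin k)) (v : Fin k → M) :
    Holds (leF t s) v ↔ leM (tval t v) (tval s v) := holds_rel _ v

/-- The interpretation of the numerals. -/
def num : ℕ → M
  | 0 => zeroM
  | n + 1 => succM (num n)

/-- The numeral of `m` as a term in an arbitrary context. -/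
def numT {k : ℕ} : ℕ → LA.Term (Empty ⊕ Fin k)
  | 0 => zeroT
  | n + 1 => succT (numT n)

theorem tval_numT {k : ℕ} (m : ℕ) (v : Fin k → M) : tval (numT m) v = num m := by
  induction m with
  | zero => exact tval_func_zero _ _
  | succ m ih => exact (tval_func_succ _ _).trans (congrArg succM ih)

theorem realize_numeral (m : ℕ) (v : Empty → M) : (numeral m).realize v = num m := by
  induction m with
  | zero => exact congrArg (Structure.funMap (L := LA) ArithFunc.zero) (Subsingleton.elim _ _)
  | succ m ih =>
    refine congrArg (Structure.funMap (L := LA) ArithFunc.succ) (List.ofFn_inj.1 ?_)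
    simpa using ih

theorem num_comp_snoc {k : ℕ} (v : Fin k → ℕ) (x : ℕ) :
    (fun i => num ((Fin.snoc v x : Fin (k + 1) → ℕ) i) : Fin (k + 1) → M) =
      Fin.snoc (fun i => num (v i)) (num x) := by
  funext i
  refine Fin.lastCases ?_ (fun i => ?_) i <;> simp

variable (M) in
/-- `M` is a model of Robinson arithmetic. -/
structure QModel : Prop where
  succ_ne : ∀ a : M, succM a ≠ zeroM
  succ_inj : ∀ a b : M, succM a = succM b → a = b
  eq_succ : ∀ a : M, a ≠ zeroM → ∃ b, a = succM b
  add_zero : ∀ a : M, addM a zeroM = a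
  add_succ : ∀ a b : M, addM a (succM b) = succM (addM a b)
  mul_zero : ∀ a : M, mulM a zeroM = zeroM
  mul_succ : ∀ a b : M, mulM a (succM b) = addM (mulM a b) a
  le_iff : ∀ a b : M, leM a b ↔ ∃ c, addM c a = b

namespace QModel

theorem add_num (H : QModel M) (a b : ℕ) : addM (num a) (num b) = (num (a + b) : M) := by
  induction b with
  | zero => exact H.add_zero _
  | succ b ih => exact (H.add_succ _ _).trans (congrArg succM ih)

theorem mul_num (H : QModel M) (a b : ℕ) : mulM (num a) (num b) = (num (a * b) : M) := by
  induction b with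
  | zero => exact H.mul_zero _
  | succ b ih =>
    refine (H.mul_succ _ _).trans ?_
    rw [ih, H.add_num]
    rfl

theorem num_inj (H : QModel M) {a b : ℕ} (h : (num a : M) = num b) : a = b := by
  induction a generalizing b with
  | zero =>
    cases b with
    | zero => rfl
    | succ b => exact absurd h.symm (H.succ_ne _)
  | succ a ih =>
    cases b with
    | zero => exact absurd h (H.succ_ne _)
    | succ b => rw [ih (H.succ_inj _ _ h)]

theorem le_num (H : QModel M) {a : M} {k : ℕ} : leM a (num k) ↔ ∃ i ≤ k, a = num i := by
  rw [H.le_iff]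
  constructor
  · rintro ⟨c, h⟩
    induction k generalizing a with
    | zero =>
      by_cases ha : a = zeroM
      · exact ⟨0, le_rfl, ha⟩
      · obtain ⟨b, rfl⟩ := H.eq_succ a ha
        rw [H.add_succ] at h
        exact absurd h (H.succ_ne _)
    | succ k ih =>
      by_cases ha : a = zeroM
      · exact ⟨0, Nat.zero_le _, ha⟩
      · obtain ⟨b, rfl⟩ := H.eq_succ a ha
        rw [H.add_succ] at h
        obtain ⟨i, hi, rfl⟩ := ih (H.succ_inj _ _ h)
        exact ⟨i + 1, Nat.succ_le_succ hi, rfl⟩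
  · rintro ⟨i, hi, rfl⟩
    exact ⟨num (k - i), by rw [H.add_num, Nat.sub_add_cancel hi]⟩

theorem le_num_or (H : QModel M) (a : M) (k : ℕ) : leM a (num k) ∨ leM (num k) a := by
  induction k generalizing a with
  | zero => exact Or.inr ((H.le_iff _ _).2 ⟨a, H.add_zero a⟩)
  | succ k ih =>
    by_cases ha : a = zeroM
    · exact Or.inl (H.le_num.2 ⟨0, Nat.zero_le _, ha⟩)
    · obtain ⟨b, rfl⟩ := H.eq_succ a ha
      refine (ih b).imp (fun h => ?_) fun h => ?_
      · obtain ⟨i, hi, rfl⟩ := H.le_num.1 h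
        exact H.le_num.2 ⟨i + 1, Nat.succ_le_succ hi, rfl⟩
      · obtain ⟨c, rfl⟩ := (H.le_iff _ _).1 h
        exact (H.le_iff _ _).2 ⟨c, H.add_succ _ _⟩

theorem tval_num (H : QModel M) {k : ℕ} (t : LA.Term (Empty ⊕ Fin k)) (v : Fin k → ℕ) :
    tval t (fun i => (num (v i) : M)) = num (tval t v) := by
  induction t with
  | var i =>
    rcases i with i | i
    · exact i.elim
    · rfl
  | func f ts ih =>
    cases f with
    | zero => rw [tval_func_zero]; rfl
    | succ => rw [tval_func_succ, ih]; rfl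
    | add => rw [tval_func_add, ih, ih, H.add_num]; rfl
    | mul => rw [tval_func_mul, ih, ih, H.mul_num]; rfl

theorem delta0_complete (H : QModel M) {k : ℕ} {φ : LA.BoundedFormula Empty k} (h : Delta0 φ)
    (v : Fin k → ℕ) : Holds φ (fun i => (num (v i) : M)) ↔ Holds φ v := by
  induction h with
  | falsum => exact Iff.rfl
  | equal t s =>
    rw [holds_equal, holds_equal, H.tval_num, H.tval_num]
    exact ⟨H.num_inj, congrArg _⟩
  | le t s =>
    rw [holds_leF_iff, holds_leF, H.tval_num, H.tval_num, H.le_num]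
    constructor
    · rintro ⟨i, hi, h⟩
      rwa [H.num_inj h]
    · exact fun h => ⟨_, h, rfl⟩
  | imp _ _ ih₁ ih₂ => exact imp_congr (ih₁ v) (ih₂ v)
  | bdall t _ ih =>
    simp only [holds_all, holds_imp, holds_leF_iff (M := M), holds_leF, tval_liftT, tval_var,
      Function.comp_apply, Fin.snoc_last, H.tval_num, H.le_num]
    constructor
    · intro h x hx
      have := h (num x) ⟨x, hx, rfl⟩
      rwa [← num_comp_snoc, ih] at this
    · rintro h _ ⟨x, hx, rfl⟩
      rw [← num_comp_snoc, ih]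
      exact h x hx

end QModel

end Operations

/-- `T` entails the instance of `φ` at the numerals of `v`. -/
def Entails (T : LA.Theory) {k : ℕ} (φ : LA.BoundedFormula Empty k) (v : Fin k → ℕ) : Prop :=
  ∀ (M : Type) [LA.Structure M] [Nonempty M], M ⊨ T → Holds φ fun i => (num (v i) : M)

theorem proves_iff {T : LA.Theory} {φ : LA.Sentence} : Proves T φ ↔
    ∀ (M : Type) [LA.Structure M] [Nonempty M], M ⊨ T → ∀ v : Fin 0 → M, Holds φ v := by
  have key : ∀ (M : Type) [LA.Structure M] (v : Fin 0 → M), M ⊨ φ ↔ Holds φ v := by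
    intro M _ v
    unfold Sentence.Realize Formula.Realize Holds
    rw [Subsingleton.elim (default : Empty → M) Empty.elim,
      Subsingleton.elim (default : Fin 0 → M) v]
  unfold Proves
  rw [Theory.models_sentence_iff]
  constructor
  · intro h M _ _ hM v
    exact (key M v).1 (h ⟨M⟩)
  · intro h M
    exact (key M default).2 (h M M.is_model default)

theorem proves_subF {T : LA.Theory} {k : ℕ} {φ : LA.BoundedFormula Empty k} {v : Fin k → ℕ} :
    Proves T (subF (fun i => numT (v i)) φ) ↔ Entails T φ v := by
  rw [proves_iff]
  refine forall_congr' fun M => forall_congr' fun _ => forall_congr' fun _ =>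
    forall_congr' fun _ => ?_
  simp only [holds_subF, tval_numT]
  exact ⟨fun h => h default, fun h _ => h⟩

theorem holds_subst1 {M : Type} [LA.Structure M] (ψ : LA.BoundedFormula Empty 1) (m : ℕ)
    (v : Fin 0 → M) : Holds (subst1 ψ m) v ↔ Holds ψ (Fin.snoc v (num m) : Fin 1 → M) := by
  unfold Holds subst1
  rw [BoundedFormula.realize_subst, Subsingleton.elim v default]
  refine (BoundedFormula.realize_toFormula ψ _).trans ?_
  refine iff_of_eq (congrArg₂ _ (Subsingleton.elim _ _) ?_)
  funext i
  rw [Subsingleton.elim i (Fin.last 0), Fin.snoc_last]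
  exact realize_numeral m _

theorem ExtendsQ.qModel {T : LA.Theory} (hQ : ExtendsQ T) (M : Type) [LA.Structure M]
    [Nonempty M] (hM : M ⊨ T) : QModel M := by
  have key : ∀ φ ∈ QTheory, Holds φ (default : Fin 0 → M) := fun φ hφ =>
    proves_iff.1 (hQ φ hφ) M hM default
  simp only [QTheory, Set.mem_insert_iff, Set.mem_singleton_iff, forall_eq_or_imp, forall_eq] at key
  obtain ⟨h₁, h₂, h₃, h₄, h₅, h₆, h₇, h₈⟩ := key
  have l₁ : ∀ a : M, (Fin.snoc default a : Fin 1 → M) 0 = a := fun _ => rfl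
  have l₂ : ∀ a b : M, (Fin.snoc (Fin.snoc default a : Fin 1 → M) b : Fin 2 → M) 0 = a :=
    fun _ _ => rfl
  have l₃ : ∀ a b : M, (Fin.snoc (Fin.snoc default a : Fin 1 → M) b : Fin 2 → M) 1 = b :=
    fun _ _ => rfl
  simp only [holds_all, holds_not, holds_imp, holds_ex, holds_equal, addT, mulT, succT, zeroT,
    tval_func_zero, tval_func_succ, tval_func_add, tval_func_mul, Matrix.cons_val_zero,
    Matrix.cons_val_one, Function.comp_apply, tval_var, l₁, l₂, l₃] at h₁ h₂ h₃ h₄ h₅ h₆ h₇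
  refine ⟨h₁, h₂, h₃, h₄, h₅, h₆, h₇, fun a b => ?_⟩
  have h := (BoundedFormula.realize_iff.1 (BoundedFormula.realize_alls.1 h₈ ![a, b]))
  refine (holds_leF_iff (&0) (&1) ![a, b]).symm.trans (h.trans ((holds_ex _ _).trans ?_))
  refine exists_congr fun c => ?_
  rw [holds_equal, addT, tval_func_add]
  rfl

theorem Consistent.of_nCon {n : ℕ} {T : LA.Theory} (h : NCon n T) : Consistent T := by
  cases n with
  | zero => exact h
  | succ n =>
    intro hT
    have h₀ : Strict 0 (⊥ : LA.BoundedFormula Empty 1) (∼⊥) := .zero .falsum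
    have h₁ : IsPi n (⊥ : LA.BoundedFormula Empty 1) := by
      cases n with
      | zero => exact .ofDelta0 .falsum
      | succ n =>
        have := (h₀.classes n).2.2.2
        rwa [Nat.zero_add] at this
    rw [proves_iff] at hT
    refine h ⟨⊥, h₁, fun m => ?_, ?_⟩
    · exact proves_iff.2 fun M _ _ hM v => (hT M hM v).elim
    · exact proves_iff.2 fun M _ _ hM v => (hT M hM v).elim

/-- In an `n`-consistent `Π_{n+1}`-deciding extension of `Q`, the prenex `Σₙ` and `Πₙ` relations
are represented by their defining formulas. -/
theorem Strict.entails {n : ℕ} {T : LA.Theory} (hQ : ExtendsQ T) (hcon : NCon n T)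
    (hdec : ∀ γ : LA.Sentence, IsPi (n + 1) γ → Proves T γ ∨ Proves T (∼γ))
    {m k : ℕ} {φ φ' : LA.BoundedFormula Empty k} (h : Strict m φ φ') (hm : m ≤ n)
    (v : Fin k → ℕ) : (Holds φ v → Entails T φ v) ∧ (¬ Holds φ v → Entails T φ' v) := by
  induction h with
  | zero h =>
    exact ⟨fun hv M _ _ hM => ((hQ.qModel M hM).delta0_complete h v).2 hv,
      fun hv M _ _ hM => fun h' => hv (((hQ.qModel M hM).delta0_complete h v).1 h')⟩
  | @succ m k φ φ' h ih =>
    replace ih := ih (Nat.le_of_succ_le hm)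
    constructor
    · rw [holds_ex]
      rintro ⟨x, hx⟩ M _ _ hM
      rw [holds_ex]
      refine ⟨num x, ?_⟩
      rw [← num_comp_snoc]
      exact (ih _).2 ((h.holds_neg _).1 hx) M hM
    · intro hv
      have hφ : ∀ x, Entails T φ (Fin.snoc v x) := by
        intro x
        refine (ih _).1 ?_
        by_contra hx
        exact hv ((holds_ex _ _).2 ⟨x, (h.holds_neg _).2 hx⟩)
      rcases hdec (GRNonRE.subF (fun i => numT (v i)) φ.all)
        ((Strict.succ h).subF _ |>.isPi (by omega))
        with hp | hp
      · exact proves_subF.1 hp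
      · exfalso
        obtain ⟨n, rfl⟩ : ∃ n', n = n' + 1 := ⟨n - 1, by omega⟩
        rw [proves_iff] at hp
        refine hcon ⟨GRNonRE.subF (liftSub fun i => numT (v i)) φ', (h.subF _).isPi (by omega),
          fun j => proves_iff.2 fun M _ _ hM w => ?_, proves_iff.2 fun M _ _ hM w => ?_⟩
        · rw [holds_not, holds_subst1, holds_subF, tval_liftSub, h.holds_neg, not_not]
          simp only [tval_numT]
          rw [← num_comp_snoc]
          exact hφ j M hM
        · have := hp M hM w
          rw [holds_not, holds_subF, holds_all, not_forall] at this
          obtain ⟨x, hx⟩ := this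
          refine (holds_ex _ _).2 ⟨x, ?_⟩
          rwa [holds_subF, tval_liftSub, h.holds_neg]

/-- Rosser's separation of two `Σ_{n+1}` sets by a `Π_{n+1}` formula. -/
theorem exists_separating_formula {n : ℕ} {T : LA.Theory} (hQ : ExtendsQ T) (hcon : NCon n T)
    (hdec : ∀ γ : LA.Sentence, IsPi (n + 1) γ → Proves T γ ∨ Proves T (∼γ))
    {A B : (Fin 1 → ℕ) → Prop} (hA : SD (n + 1) A) (hB : SD (n + 1) B) :
    ∃ ρ : LA.BoundedFormula Empty 1, ∀ v,
      IsPi (n + 1) (subF (fun i => numT (v i)) ρ : LA.Sentence) ∧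
      (A v → ¬ B v → Entails T (∼ρ) v) ∧ (B v → ¬ A v → Entails T ρ v) := by
  obtain ⟨SA, hSA, hA⟩ := hA
  obtain ⟨SB, hSB, hB⟩ := hB
  obtain ⟨a, a', ha, hSA⟩ := hSA.strict
  obtain ⟨b, b', hb, hSB⟩ := hSB.strict
  let τ : Fin 2 → LA.Term (Empty ⊕ Fin 3) := ![&0, &2]
  have hτ : ∀ {M : Type} [LA.Structure M] (v : Fin 1 → M) (y z : M),
      (fun i => tval (τ i) (Fin.snoc (Fin.snoc v y : Fin 2 → M) z : Fin 3 → M)) =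
        Fin.snoc v z := by
    intro M _ v y z
    funext i
    fin_cases i <;> rfl
  refine ⟨(a ⊔ (leF (&(Fin.last 2)) (liftT (&(Fin.last 1))) ⊓ subF τ b').ex).all,
    fun v => ⟨?_, ?_, ?_⟩⟩
  · refine IsPi.all (IsPi.sup (ha.subF _ |>.classes 0).2.2.2 ?_)
    change IsPi (n + 1) (subF _ (leF _ _) ⊓ subF _ (subF τ b')).ex
    rw [subF_leF, subT_liftT, subT_liftSub_last]
    exact IsPi.bdex _ (((hb.subF _).subF _).isPi (Nat.le_succ n))
  · rw [hA, hB]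
    push Not
    rintro ⟨y, hy⟩ hz M _ _ hM
    rw [holds_not, holds_all]
    intro h
    have h := h (num y)
    simp only [holds_sup, holds_ex, holds_inf, holds_leF_iff, holds_subF, hτ, tval_liftT,
      Function.comp_apply, tval_var, Fin.snoc_last, (hQ.qModel M hM).le_num] at h
    rcases h with h | ⟨_, ⟨z, _, rfl⟩, h⟩
    · rw [← num_comp_snoc] at h
      rw [hSA] at hy
      exact (ha.holds_neg _).1 ((ha.entails hQ hcon hdec le_rfl _).2 hy M hM) h
    · rw [← num_comp_snoc] at h
      exact (hb.holds_neg _).1 h ((hb.entails hQ hcon hdec le_rfl _).1 ((hSB _).1 (hz z)) M hM)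
  · rw [hA, hB]
    push Not
    rintro ⟨z, hz⟩ hy M _ _ hM
    rw [holds_all]
    intro y
    simp only [holds_sup, holds_ex, holds_inf, holds_leF_iff, holds_subF, hτ, tval_liftT,
      Function.comp_apply, tval_var, Fin.snoc_last]
    rcases (hQ.qModel M hM).le_num_or y z with h | h
    · left
      obtain ⟨i, _, rfl⟩ := (hQ.qModel M hM).le_num.1 h
      rw [← num_comp_snoc]
      exact (ha.entails hQ hcon hdec le_rfl _).1 ((hSA _).1 (hy i)) M hM
    · right
      refine ⟨num z, h, ?_⟩
      rw [← num_comp_snoc]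
      rw [hSB] at hz
      exact (hb.entails hQ hcon hdec le_rfl _).2 hz M hM

/-- If the entailed and the refuted instances of unary formulas at their own codes are
`Σ_{n+1}`, then `T` does not decide all `Π_{n+1}` sentences. -/
theorem exists_undecided {n : ℕ} {T : LA.Theory} (hQ : ExtendsQ T) (hcon : NCon n T)
    {A B : (Fin 1 → ℕ) → Prop} (hA : SD (n + 1) A) (hB : SD (n + 1) B)
    (code : LA.BoundedFormula Empty 1 → Fin 1 → ℕ)
    (hcA : ∀ ρ, A (code ρ) ↔ Entails T ρ (code ρ))
    (hcB : ∀ ρ, B (code ρ) ↔ Entails T (∼ρ) (code ρ)) :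
    ∃ γ : LA.Sentence, IsPi (n + 1) γ ∧ ¬ Proves T γ ∧ ¬ Proves T (∼γ) := by
  by_contra hne
  have hdec : ∀ γ : LA.Sentence, IsPi (n + 1) γ → Proves T γ ∨ Proves T (∼γ) := by
    intro γ hγ
    by_contra h
    rw [not_or] at h
    exact hne ⟨γ, hγ, h⟩
  obtain ⟨ρ, hρ⟩ := exists_separating_formula hQ hcon hdec hA hB
  obtain ⟨hpi, h₁, h₂⟩ := hρ (code ρ)
  rw [hcA, hcB] at h₁ h₂
  have hcons : ¬ (Entails T ρ (code ρ) ∧ Entails T (∼ρ) (code ρ)) := by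
    rintro ⟨h, h'⟩
    exact Consistent.of_nCon hcon (proves_iff.2 fun M _ _ hM v => h' M hM (h M hM))
  rcases hdec _ hpi with h | h
  · have hA := proves_subF.1 h
    exact hcons ⟨hA, h₁ hA fun hB => hcons ⟨hA, hB⟩⟩
  · have hB : Entails T (∼ρ) (code ρ) := proves_subF.1 h
    exact hcons ⟨h₂ hB fun hA => hcons ⟨hA, hB⟩, hB⟩

/-- A valuation satisfies a clause, given as a list of atoms with signs. -/
def SatClause (w : ℕ → Bool) (c : List (ℕ × Bool)) : Prop := ∃ l ∈ c, w l.1 = l.2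

/-- A set of clauses is satisfiable. -/
def Satisfiable (K : List (ℕ × Bool) → Prop) : Prop := ∃ w, ∀ c, K c → SatClause w c

/-- All atoms of the clause `c` are below `B`, and the valuation given by the binary digits of `v`
falsifies `c`. -/
def Falsifies (B v : ℕ) (c : List (ℕ × Bool)) : Prop :=
  ∀ l ∈ c, l.1 < B ∧ decide (v / 2 ^ l.1 % 2 = 1) ≠ l.2

theorem not_satisfiable_iff (K : List (ℕ × Bool) → Prop) :
    ¬ Satisfiable K ↔ ∃ B, ∀ v ≤ 2 ^ B, ∃ c, K c ∧ Falsifies B v c := by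
  constructor
  · contrapose!
    intro h
    choose v _ hv using h
    let U := Filter.hyperfilter ℕ
    classical
    refine ⟨fun a => decide (∀ᶠ B in U, decide (v B / 2 ^ a % 2 = 1) = true), fun c hc => ?_⟩
    by_contra hne
    have key : ∀ l ∈ {l | l ∈ c}, ∀ᶠ B in U, l.1 < B ∧ decide (v B / 2 ^ l.1 % 2 = 1) ≠ l.2 := by
      rintro ⟨a, s⟩ hl
      have h₁ : ∀ᶠ B in U, a < B := by
        have : ∀ᶠ B in Filter.atTop, a < B := Filter.eventually_gt_atTop a
        rw [← Nat.cofinite_eq_atTop] at this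
        exact Filter.hyperfilter_le_cofinite this
      refine h₁.and ?_
      have h₂ : ¬ decide (∀ᶠ B in U, decide (v B / 2 ^ a % 2 = 1) = true) = s :=
        fun h => hne ⟨_, hl, h⟩
      cases s
      · have h₃ : ∀ᶠ B in U, decide (v B / 2 ^ a % 2 = 1) = true := by simpa using h₂
        exact h₃.mono fun B hB => by simp [hB]
      · have h₃ : ¬ ∀ᶠ B in U, decide (v B / 2 ^ a % 2 = 1) = true := by simpa using h₂
        exact Ultrafilter.eventually_not.2 h₃
    obtain ⟨B, hB⟩ := ((Filter.eventually_all_finite c.finite_toSet).2 key).exists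
    exact hv B c hc hB
  · rintro ⟨B, hB⟩ ⟨w, hw⟩
    obtain ⟨c, hc, hf⟩ := hB (Nat.ofBits fun i : Fin B => w i) (Nat.ofBits_lt_two_pow _).le
    obtain ⟨l, hl, h⟩ := hw c hc
    obtain ⟨h₁, h₂⟩ := hf l hl
    rw [← Nat.testBit_eq_decide_div_mod_eq, Nat.testBit_ofBits_lt _ _ h₁] at h₂
    exact h₂ h

theorem primrec_two_pow : Primrec fun n : ℕ => 2 ^ n := by
  refine (Primrec.nat_rec₁ 1 (Primrec.nat_mul.comp (Primrec.const 2) Primrec.snd).to₂).of_eq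
    fun n => ?_
  induction n with
  | zero => rfl
  | succ n ih => rw [pow_succ, mul_comm, ← ih]

/-- Decoding of natural numbers, with a default value for codes out of range. -/
def ofCode (α : Type) [Inhabited α] [Encodable α] (n : ℕ) : α := (Encodable.decode n).getD default

theorem ofCode_encode {α : Type} [Inhabited α] [Encodable α] (a : α) :
    ofCode α (Encodable.encode a) = a := by
  simp [ofCode]

theorem primrec_ofCode {α : Type} [Inhabited α] [Primcodable α] : Primrec (ofCode α) :=
  Primrec.option_getD.comp Primrec.decode (Primrec.const default)

theorem primrecPred_falsifies :
    PrimrecPred fun p : ℕ × ℕ × ℕ => Falsifies p.1 p.2.1 (ofCode (List (ℕ × Bool)) p.2.2) := by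
  have h : PrimrecRel fun (l : ℕ × Bool) (q : ℕ × ℕ) =>
      l.1 < q.1 ∧ decide (q.2 / 2 ^ l.1 % 2 = 1) ≠ l.2 := by
    have hl : Primrec fun x : (ℕ × Bool) × (ℕ × ℕ) => x.1.1 := Primrec.fst.comp Primrec.fst
    refine PrimrecPred.and (Primrec.nat_lt.comp hl (Primrec.fst.comp Primrec.snd))
      (PrimrecPred.not (Primrec.eq.comp ?_ (Primrec.snd.comp Primrec.fst)))
    have := Primrec.eq.comp (Primrec.nat_mod.comp (Primrec.nat_div.comp
      (Primrec.snd.comp Primrec.snd) (primrec_two_pow.comp hl)) (Primrec.const 2))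
      (Primrec.const 1)
    exact this.decide
  have := PrimrecRel.forall_mem_list h
  refine PrimrecPred.of_eq (PrimrecRel.comp this
    (primrec_ofCode.comp (Primrec.snd.comp Primrec.snd))
    (Primrec.fst.pair (Primrec.fst.comp Primrec.snd))) fun p => Iff.rfl

theorem SD.not_satisfiable {n : ℕ} {K : (Fin 1 → ℕ) → List (ℕ × Bool) → Prop}
    (hK : SD (n + 1) fun v : Fin 2 → ℕ => K ![v 0] (ofCode (List (ℕ × Bool)) (v 1))) :
    SD (n + 1) fun v => ¬ Satisfiable (K v) := by
  have hpow : PrimrecPred fun p : ℕ × ℕ × ℕ => 2 ^ p.1 = p.2.1 :=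
    Primrec.eq.comp (primrec_two_pow.comp Primrec.fst) (Primrec.fst.comp Primrec.snd)
  refine SD.congr (R := fun v => ∃ B P, 2 ^ B = P ∧ ∀ w ≤ P, ∃ c,
    K ![v 0] (ofCode (List (ℕ × Bool)) c) ∧ Falsifies B w (ofCode (List (ℕ × Bool)) c)) ?_ ?_
  · refine SD.exists (SD.exists (SD.and ?_ (SD.forall_le 2 (SD.exists (SD.and ?_ ?_)))))
    · exact (SD.of_primrec hpow 1 2 2).mono (Nat.le_add_left 1 n)
    · exact hK.proj ![0, 4]
    · exact (SD.of_primrec primrecPred_falsifies 1 3 4).mono (Nat.le_add_left 1 n)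
  · intro v
    have hv : ![v 0] = v := List.ofFn_inj.1 rfl
    rw [not_satisfiable_iff, hv]
    constructor
    · rintro ⟨B, h⟩
      refine ⟨B, _, rfl, fun w hw => ?_⟩
      obtain ⟨c, h₁, h₂⟩ := h w hw
      exact ⟨Encodable.encode c, by rwa [ofCode_encode], by rwa [ofCode_encode]⟩
    · rintro ⟨B, _, rfl, h⟩
      refine ⟨B, fun w hw => ?_⟩
      obtain ⟨c, h⟩ := h w hw
      exact ⟨_, h⟩

/-- An algebra of the function symbols of arithmetic. -/
structure Alg (A : Type) where
  /-- interpretation of `0` -/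
  zero : A
  /-- interpretation of `S` -/
  succ : A → A
  /-- interpretation of `+` -/
  add : A → A → A
  /-- interpretation of `×` -/
  mul : A → A → A

/-- One step of the evaluation of a term in Polish notation with a stack. -/
def Alg.step {A : Type} (I : Alg A) (env : List A) (tok : ℕ) (st : List A) : List A :=
  if tok % 2 = 0 then env.getD (tok / 4) I.zero :: st
  else if tok = 1 then I.zero :: st
  else if tok = 3 then I.succ (st.getD 0 I.zero) :: st.drop 1
  else if tok = 5 then I.add (st.getD 0 I.zero) (st.getD 1 I.zero) :: st.drop 2
  else I.mul (st.getD 0 I.zero) (st.getD 1 I.zero) :: st.drop 2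

/-- The value of the term with code `t` under the assignment `env`. -/
def Alg.val {A : Type} (I : Alg A) (t : ℕ) (env : List A) : A :=
  ((ofCode (List ℕ) t).foldr (I.step env) []).getD 0 I.zero

/-- Homomorphisms of algebras. -/
structure Alg.Hom {A B : Type} (I : Alg A) (J : Alg B) (f : A → B) : Prop where
  zero : f I.zero = J.zero
  succ : ∀ a, f (I.succ a) = J.succ (f a)
  add : ∀ a b, f (I.add a b) = J.add (f a) (f b)
  mul : ∀ a b, f (I.mul a b) = J.mul (f a) (f b)

theorem Alg.Hom.val {A B : Type} {I : Alg A} {J : Alg B} {f : A → B} (h : I.Hom J f)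
    (t : ℕ) (env : List A) : f (I.val t env) = J.val t (env.map f) := by
  have hget : ∀ (l : List A) (i : ℕ), f (l.getD i I.zero) = (l.map f).getD i J.zero := by
    intro l i
    rw [← h.zero, List.getD_map]
  have key : ∀ l : List ℕ, (l.foldr (I.step env) []).map f = l.foldr (J.step (env.map f)) [] := by
    intro l
    induction l with
    | nil => rfl
    | cons tok l ih =>
      simp only [List.foldr_cons, ← ih, Alg.step]
      split_ifs <;>
        simp only [List.map_cons, List.map_drop, hget, h.zero, h.succ, h.add, h.mul]
  unfold Alg.val
  rw [hget, key]

/-- The algebra of a structure. -/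
def algOf (M : Type) [LA.Structure M] : Alg M := ⟨zeroM, succM, addM, mulM⟩

/-- The code of a term. -/
def termCode {k : ℕ} (t : LA.Term (Empty ⊕ Fin k)) : ℕ :=
  Encodable.encode (t.listEncode.map Encodable.encode)

theorem foldr_listEncode {M : Type} [LA.Structure M] {k : ℕ} (t : LA.Term (Empty ⊕ Fin k))
    (v : Fin k → M) (l : List ℕ) :
    (t.listEncode.map Encodable.encode ++ l).foldr ((algOf M).step (List.ofFn v)) [] =
      tval t v :: l.foldr ((algOf M).step (List.ofFn v)) [] := by
  induction t generalizing l with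
  | var i =>
    rcases i with i | i
    · exact i.elim
    · have : Encodable.encode (Sum.inl (Sum.inr i) : (Empty ⊕ Fin k) ⊕ (Σ i, LA.Functions i)) =
          2 * (2 * i.val + 1) := rfl
      simp only [Term.listEncode, List.map_cons, List.map_nil, List.cons_append, List.nil_append,
        List.foldr_cons, this, Alg.step, tval_var]
      rw [if_pos (by omega), show 2 * (2 * i.val + 1) / 4 = i.val by omega]
      simp
  | func f ts ih =>
    cases f with
    | zero =>
      rw [tval_func_zero]
      rfl
    | succ =>
      have h : List.map Encodable.encode (Term.func (L := LA) ArithFunc.succ ts).listEncode ++ l =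
          3 :: ((ts 0).listEncode.map Encodable.encode ++ l) := by
        simp [Term.listEncode, List.finRange_succ]
        rfl
      rw [h, List.foldr_cons, ih, tval_func_succ]
      rfl
    | add =>
      have h : List.map Encodable.encode (Term.func (L := LA) ArithFunc.add ts).listEncode ++ l =
          5 :: ((ts 0).listEncode.map Encodable.encode ++
            ((ts 1).listEncode.map Encodable.encode ++ l)) := by
        simp [Term.listEncode, List.finRange_succ]
        rfl
      rw [h, List.foldr_cons, ih, ih, tval_func_add]
      rfl
    | mul =>
      have h : List.map Encodable.encode (Term.func (L := LA) ArithFunc.mul ts).listEncode ++ l =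
          7 :: ((ts 0).listEncode.map Encodable.encode ++
            ((ts 1).listEncode.map Encodable.encode ++ l)) := by
        simp [Term.listEncode, List.finRange_succ]
        rfl
      rw [h, List.foldr_cons, ih, ih, tval_func_mul]
      rfl

theorem val_termCode {M : Type} [LA.Structure M] {k : ℕ} (t : LA.Term (Empty ⊕ Fin k))
    (v : Fin k → M) : (algOf M).val (termCode t) (List.ofFn v) = tval t v := by
  unfold Alg.val termCode
  rw [ofCode_encode]
  have := foldr_listEncode t v []
  rw [List.append_nil] at this
  rw [this]
  rfl

/-- The structural code of a formula. -/
def formCode : ∀ {k : ℕ}, LA.BoundedFormula Empty k → ℕ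
  | _, .falsum => Nat.pair 0 0
  | _, .equal t s => Nat.pair 1 (Nat.pair (termCode t) (termCode s))
  | _, .rel (l := l) R ts => match l, R, ts with
    | _, ArithRel.le, ts => Nat.pair 2 (Nat.pair (termCode (ts 0)) (termCode (ts 1)))
  | _, .imp φ ψ => Nat.pair 3 (Nat.pair (formCode φ) (formCode ψ))
  | _, .all φ => Nat.pair 4 (formCode φ)

/-- One step of parsing a formula in Polish notation. The state consists of the stack of codes of
parsed formulas before and after the last symbol; the code `Nat.pair 5 t` stands for a term waiting
for its companion in an atomic formula. -/
def parseStep (tok : ℕ) (s : List ℕ × List ℕ) : List ℕ × List ℕ :=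
  (if tok = 1 then Nat.pair 2 (s.2.getD 0 0).unpair.2 :: s.2.drop 1
    else if tok % 2 = 0 then
      if (s.1.getD 0 0).unpair.1 = 5 then
        Nat.pair 1 (Nat.pair (tok / 2).unpair.2 (s.1.getD 0 0).unpair.2) :: s.1.drop 1
      else Nat.pair 5 (tok / 2).unpair.2 :: s.1
    else if tok = 3 then Nat.pair 3 (Nat.pair (s.1.getD 0 0) (s.1.getD 1 0)) :: s.1.drop 2
    else if tok = 7 then Nat.pair 4 (s.1.getD 0 0) :: s.1.drop 1
    else Nat.pair 0 0 :: s.1, s.1)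

/-- The structural code of the formula with Gödel number `g`. -/
def parse (g : ℕ) : ℕ := ((ofCode (List ℕ) g).foldr parseStep ([], [])).1.getD 0 0

theorem encode_list {α : Type} [Encodable α] (l : List α) :
    Encodable.encode l = Encodable.encode (l.map Encodable.encode) := by
  induction l with
  | nil => rfl
  | cons a l ih => rw [List.map_cons, Encodable.encode_list_cons, Encodable.encode_list_cons, ih,
      Encodable.encode_nat]

theorem formCode_tag {k : ℕ} (φ : LA.BoundedFormula Empty k) : (formCode φ).unpair.1 ≠ 5 := by
  cases φ with
  | rel R ts => cases R; simp [formCode]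
  | _ => simp [formCode]

theorem parseStep_parseStep (j k t u : ℕ) (s : List ℕ × List ℕ)
    (hs : (s.1.getD 0 0).unpair.1 ≠ 5) :
    (parseStep (2 * Nat.pair j t) (parseStep (2 * Nat.pair k u) s)).1 =
      Nat.pair 1 (Nat.pair t u) :: s.1 := by
  have h : ∀ m, 2 * m ≠ 1 := fun m => by omega
  have h₁ : (parseStep (2 * Nat.pair k u) s).1 = Nat.pair 5 u :: s.1 := by
    rw [parseStep, if_neg (h _), if_pos (Nat.mul_mod_right _ _), if_neg hs,
      Nat.mul_div_cancel_left _ two_pos, Nat.unpair_pair]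
  rw [parseStep, h₁, if_neg (h _), if_pos (Nat.mul_mod_right _ _),
    Nat.mul_div_cancel_left _ two_pos]
  simp

theorem foldr_parseStep {k : ℕ} (φ : LA.BoundedFormula Empty k) (l : List ℕ)
    (hl : ((l.foldr parseStep ([], [])).1.getD 0 0).unpair.1 ≠ 5) :
    ((φ.listEncode.map Encodable.encode ++ l).foldr parseStep ([], [])).1 =
      formCode φ :: (l.foldr parseStep ([], [])).1 := by
  have hterm : ∀ {k : ℕ} (t : LA.Term (Empty ⊕ Fin k)), Encodable.encode
      (Sum.inl ⟨k, t⟩ : (Σ k, LA.Term (Empty ⊕ Fin k)) ⊕ ((Σ n, LA.Relations n) ⊕ ℕ)) =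
        2 * Nat.pair k (termCode t) := by
    intro k t
    rw [termCode, ← encode_list]
    rfl
  induction φ generalizing l with
  | @falsum k =>
    have h : List.map Encodable.encode
        (BoundedFormula.falsum : LA.BoundedFormula Empty k).listEncode =
        [2 * (2 * (k + 2) + 1) + 1] := rfl
    rw [h, List.singleton_append, List.foldr_cons]
    simp only [parseStep, formCode]
    rw [if_neg (by omega), if_neg (by omega), if_neg (by omega), if_neg (by omega)]
  | equal t s =>
    simp only [BoundedFormula.listEncode, List.map_cons, List.map_nil, List.cons_append,
      List.nil_append, List.foldr_cons, hterm]
    exact parseStep_parseStep _ _ _ _ _ hl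
  | @rel k _ R ts =>
    cases R
    have h : List.map Encodable.encode
        (BoundedFormula.rel (L := LA) ArithRel.le ts).listEncode ++ l =
        1 :: (4 * k + 3) :: 2 * Nat.pair k (termCode (ts 0)) ::
          2 * Nat.pair k (termCode (ts 1)) :: l := by
      simp [BoundedFormula.listEncode, List.finRange_succ, hterm]
      exact ⟨rfl, by omega⟩
    rw [h, List.foldr_cons, List.foldr_cons, List.foldr_cons, List.foldr_cons]
    have := parseStep_parseStep k k (termCode (ts 0)) (termCode (ts 1)) _ hl
    rw [parseStep, if_pos rfl, parseStep, this]
    simp [formCode]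
  | imp φ ψ ih₁ ih₂ =>
    have h : List.map Encodable.encode (φ.imp ψ).listEncode ++ l =
        3 :: (φ.listEncode.map Encodable.encode ++ (ψ.listEncode.map Encodable.encode ++ l)) := by
      simp [BoundedFormula.listEncode]
    have hψ := ih₂ l hl
    rw [h, List.foldr_cons, parseStep]
    rw [ih₁ _ (by rw [hψ]; exact formCode_tag ψ), hψ]
    rfl
  | all φ ih =>
    have h : List.map Encodable.encode φ.all.listEncode ++ l =
        7 :: (φ.listEncode.map Encodable.encode ++ l) := by
      simp [BoundedFormula.listEncode]
    rw [h, List.foldr_cons, parseStep, ih l hl]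
    rfl

theorem parse_godel {k : ℕ} (φ : LA.BoundedFormula Empty k) : parse (godel φ) = formCode φ := by
  have := foldr_parseStep φ [] (by simp)
  rw [List.append_nil] at this
  rw [parse, godel, encode_list, ofCode_encode, this]
  rfl

/-- The algebra of codes of closed terms with Henkin constants. -/
def herb : Alg ℕ :=
  ⟨Nat.pair 0 0, Nat.pair 1, fun a b => Nat.pair 2 (Nat.pair a b),
    fun a b => Nat.pair 3 (Nat.pair a b)⟩

section Primrec

variable {α : Type} [Primcodable α] {f g : α → ℕ} {l : α → List ℕ}

theorem primrec_pair (hf : Primrec f) (hg : Primrec g) : Primrec fun a => Nat.pair (f a) (g a) :=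
  Primrec₂.natPair.comp hf hg

theorem primrec_tag (k : ℕ) (hf : Primrec f) : Primrec fun a => Nat.pair k (f a) :=
  primrec_pair (Primrec.const k) hf

theorem primrec_unpair_fst (hf : Primrec f) : Primrec fun a => (f a).unpair.1 :=
  Primrec.fst.comp (Primrec.unpair.comp hf)

theorem primrec_unpair_snd (hf : Primrec f) : Primrec fun a => (f a).unpair.2 :=
  Primrec.snd.comp (Primrec.unpair.comp hf)

theorem primrec_getD (d : ℕ) (hl : Primrec l) (hf : Primrec f) :
    Primrec fun a => (l a).getD (f a) d :=
  (Primrec.list_getD d).comp hl hf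

theorem primrec_drop (k : ℕ) (hl : Primrec l) : Primrec fun a => (l a).drop k := by
  induction k with
  | zero => exact hl
  | succ k ih => exact (Primrec.list_tail.comp ih).of_eq fun a => List.tail_drop

theorem primrec_val (hf : Primrec f) (hl : Primrec l) : Primrec fun a => herb.val (f a) (l a) := by
  refine primrec_getD _ ?_ (Primrec.const 0)
  refine Primrec.list_foldr (h := fun a q => herb.step (l a) q.1 q.2)
    (primrec_ofCode.comp hf) (Primrec.const []) ?_
  have htok : Primrec fun q : α × ℕ × List ℕ => q.2.1 := Primrec.fst.comp Primrec.snd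
  have hst : Primrec fun q : α × ℕ × List ℕ => q.2.2 := Primrec.snd.comp Primrec.snd
  have hmod := Primrec.nat_mod.comp htok (Primrec.const 2)
  have h₀ := primrec_getD herb.zero hst (Primrec.const 0)
  have h₁ := primrec_getD herb.zero hst (Primrec.const 1)
  refine Primrec.ite (Primrec.eq.comp hmod (Primrec.const 0)) ?_
    (Primrec.ite (Primrec.eq.comp htok (Primrec.const 1)) ?_
    (Primrec.ite (Primrec.eq.comp htok (Primrec.const 3)) ?_
    (Primrec.ite (Primrec.eq.comp htok (Primrec.const 5)) ?_ ?_)))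
  · exact Primrec.list_cons.comp (primrec_getD _ (hl.comp Primrec.fst)
      (Primrec.nat_div.comp htok (Primrec.const 4))) hst
  · exact Primrec.list_cons.comp (Primrec.const _) hst
  · exact Primrec.list_cons.comp (primrec_tag 1 h₀) (primrec_drop 1 hst)
  · exact Primrec.list_cons.comp (primrec_tag 2 (primrec_pair h₀ h₁)) (primrec_drop 2 hst)
  · exact Primrec.list_cons.comp (primrec_tag 3 (primrec_pair h₀ h₁)) (primrec_drop 2 hst)

theorem primrec_parse : Primrec parse := by
  refine primrec_getD _ (Primrec.fst.comp ?_) (Primrec.const 0)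
  refine Primrec.list_foldr (h := fun _ q => parseStep q.1 q.2)
    primrec_ofCode (Primrec.const ([], [])) ?_
  have htok : Primrec fun q : ℕ × ℕ × List ℕ × List ℕ => q.2.1 := Primrec.fst.comp Primrec.snd
  have hs : Primrec fun q : ℕ × ℕ × List ℕ × List ℕ => q.2.2.1 :=
    Primrec.fst.comp (Primrec.snd.comp Primrec.snd)
  have hp : Primrec fun q : ℕ × ℕ × List ℕ × List ℕ => q.2.2.2 :=
    Primrec.snd.comp (Primrec.snd.comp Primrec.snd)
  have h₀ := primrec_getD 0 hs (Primrec.const 0)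
  have h₁ := primrec_getD 0 hs (Primrec.const 1)
  have ht := primrec_unpair_snd (Primrec.nat_div.comp htok (Primrec.const 2))
  refine Primrec.pair (Primrec.ite (Primrec.eq.comp htok (Primrec.const 1)) ?_
    (Primrec.ite (Primrec.eq.comp (Primrec.nat_mod.comp htok (Primrec.const 2)) (Primrec.const 0))
      (Primrec.ite (Primrec.eq.comp (primrec_unpair_fst h₀) (Primrec.const 5)) ?_ ?_)
    (Primrec.ite (Primrec.eq.comp htok (Primrec.const 3)) ?_
    (Primrec.ite (Primrec.eq.comp htok (Primrec.const 7)) ?_ ?_)))) hs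
  · exact Primrec.list_cons.comp (primrec_tag 2 (primrec_unpair_snd
      (primrec_getD 0 hp (Primrec.const 0)))) (primrec_drop 1 hp)
  · exact Primrec.list_cons.comp (primrec_tag 1 (primrec_pair ht (primrec_unpair_snd h₀)))
      (primrec_drop 1 hs)
  · exact Primrec.list_cons.comp (primrec_tag 5 ht) hs
  · exact Primrec.list_cons.comp (primrec_tag 3 (primrec_pair h₀ h₁)) (primrec_drop 2 hs)
  · exact Primrec.list_cons.comp (primrec_tag 4 h₀) (primrec_drop 1 hs)
  · exact Primrec.list_cons.comp (Primrec.const _) hs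

end Primrec

/-- The atom stating that two constants are equal. -/
def atomE (c d : ℕ) : ℕ := Nat.pair 0 (Nat.pair c d)

/-- The atom stating that one constant is at most another. -/
def atomL (c d : ℕ) : ℕ := Nat.pair 1 (Nat.pair c d)

/-- The atom stating that the formula with code `a` holds at the constants `e`. -/
def atomF (a : ℕ) (e : List ℕ) : ℕ := Nat.pair 2 (Nat.pair a (Encodable.encode e))

/-- The Henkin constant for a counterexample to the formula with code `a` at the constants `e`. -/
def henkin (a : ℕ) (e : List ℕ) : ℕ := Nat.pair 4 (Nat.pair a (Encodable.encode e))

/-- The clause with the given premises and conclusion. -/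
def rule (hyps : List ℕ) (concl : ℕ) : List (ℕ × Bool) :=
  (concl, true) :: hyps.map fun a => (a, false)

/-- The clauses of equality and of Tarski's truth conditions with the given parameters. -/
def logicClauses : ℕ × ℕ × ℕ × ℕ × List ℕ → List (List (ℕ × Bool))
  | (a, b, c, d, e) =>
    [rule [] (atomE a a),
      rule [atomE a b] (atomE b a),
      rule [atomE a b, atomE b c] (atomE a c),
      rule [atomE a b] (atomE (herb.succ a) (herb.succ b)),
      rule [atomE a b, atomE c d] (atomE (herb.add a c) (herb.add b d)),
      rule [atomE a b, atomE c d] (atomE (herb.mul a c) (herb.mul b d)),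
      rule [atomE a b, atomE c d, atomL a c] (atomL b d),
      [(atomF (Nat.pair 0 0) e, false)],
      rule [atomF (Nat.pair 1 (Nat.pair a b)) e] (atomE (herb.val a e) (herb.val b e)),
      rule [atomE (herb.val a e) (herb.val b e)] (atomF (Nat.pair 1 (Nat.pair a b)) e),
      rule [atomF (Nat.pair 2 (Nat.pair a b)) e] (atomL (herb.val a e) (herb.val b e)),
      rule [atomL (herb.val a e) (herb.val b e)] (atomF (Nat.pair 2 (Nat.pair a b)) e),
      rule [atomF (Nat.pair 3 (Nat.pair a b)) e, atomF a e] (atomF b e),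
      [(atomF (Nat.pair 3 (Nat.pair a b)) e, true), (atomF a e, true)],
      rule [atomF b e] (atomF (Nat.pair 3 (Nat.pair a b)) e),
      rule [atomF (Nat.pair 4 a) e] (atomF a (e ++ [c])),
      rule [atomF a (e ++ [henkin a e])] (atomF (Nat.pair 4 a) e)]

section Primrec

variable {α : Type} [Primcodable α]

theorem primrec_cons {σ : Type} [Primcodable σ] {f : α → σ} {l : α → List σ} (hf : Primrec f)
    (hl : Primrec l) : Primrec fun a => f a :: l a :=
  Primrec.list_cons.comp hf hl

theorem primrec_atomF {f : α → ℕ} {l : α → List ℕ} (hf : Primrec f) (hl : Primrec l) :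
    Primrec fun a => atomF (f a) (l a) :=
  primrec_tag 2 (primrec_pair hf (Primrec.encode.comp hl))

theorem primrec_rule {f : α → ℕ} {l : α → List ℕ} (hl : Primrec l) (hf : Primrec f) :
    Primrec fun a => rule (l a) (f a) := by
  refine primrec_cons (hf.pair (Primrec.const true)) (Primrec.list_map hl ?_)
  exact (Primrec.snd.pair (Primrec.const false)).to₂

theorem primrec_snoc {f : α → ℕ} {l : α → List ℕ} (hl : Primrec l) (hf : Primrec f) :
    Primrec fun a => l a ++ [f a] :=
  Primrec.list_append.comp hl (primrec_cons hf (Primrec.const []))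

end Primrec

theorem primrec_logicClauses : Primrec logicClauses := by
  have ha : Primrec fun p : ℕ × ℕ × ℕ × ℕ × List ℕ => p.1 := Primrec.fst
  have hb : Primrec fun p : ℕ × ℕ × ℕ × ℕ × List ℕ => p.2.1 := Primrec.fst.comp Primrec.snd
  have hc : Primrec fun p : ℕ × ℕ × ℕ × ℕ × List ℕ => p.2.2.1 :=
    Primrec.fst.comp (Primrec.snd.comp Primrec.snd)
  have hd : Primrec fun p : ℕ × ℕ × ℕ × ℕ × List ℕ => p.2.2.2.1 :=
    Primrec.fst.comp (Primrec.snd.comp (Primrec.snd.comp Primrec.snd))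
  have he : Primrec fun p : ℕ × ℕ × ℕ × ℕ × List ℕ => p.2.2.2.2 :=
    Primrec.snd.comp (Primrec.snd.comp (Primrec.snd.comp Primrec.snd))
  have nil : Primrec fun _ : ℕ × ℕ × ℕ × ℕ × List ℕ => ([] : List ℕ) := Primrec.const []
  have nil' : Primrec fun _ : ℕ × ℕ × ℕ × ℕ × List ℕ => ([] : List (ℕ × Bool)) := Primrec.const []
  have hva := primrec_val ha he
  have hvb := primrec_val hb he
  have hE := primrec_tag 0 (primrec_pair hva hvb)
  have hL := primrec_tag 1 (primrec_pair hva hvb)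
  have hF := fun k => primrec_atomF (primrec_tag k (primrec_pair ha hb)) he
  have hall := primrec_atomF (primrec_tag 4 ha) he
  have hEab := primrec_tag 0 (primrec_pair ha hb)
  have hEcd := primrec_tag 0 (primrec_pair hc hd)
  refine primrec_cons (primrec_rule nil (primrec_tag 0 (primrec_pair ha ha))) ?_
  refine primrec_cons (primrec_rule (primrec_cons hEab nil)
    (primrec_tag 0 (primrec_pair hb ha))) ?_
  refine primrec_cons (primrec_rule (primrec_cons hEab
    (primrec_cons (primrec_tag 0 (primrec_pair hb hc)) nil))
    (primrec_tag 0 (primrec_pair ha hc))) ?_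
  refine primrec_cons (primrec_rule (primrec_cons hEab nil)
    (primrec_tag 0 (primrec_pair (primrec_tag 1 ha) (primrec_tag 1 hb)))) ?_
  refine primrec_cons (primrec_rule (primrec_cons hEab (primrec_cons hEcd nil))
    (primrec_tag 0 (primrec_pair (primrec_tag 2 (primrec_pair ha hc))
      (primrec_tag 2 (primrec_pair hb hd))))) ?_
  refine primrec_cons (primrec_rule (primrec_cons hEab (primrec_cons hEcd nil))
    (primrec_tag 0 (primrec_pair (primrec_tag 3 (primrec_pair ha hc))
      (primrec_tag 3 (primrec_pair hb hd))))) ?_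
  refine primrec_cons (primrec_rule (primrec_cons hEab (primrec_cons hEcd
    (primrec_cons (primrec_tag 1 (primrec_pair ha hc)) nil)))
    (primrec_tag 1 (primrec_pair hb hd))) ?_
  refine primrec_cons (primrec_cons ((primrec_atomF (Primrec.const _) he).pair
    (Primrec.const false)) nil') ?_
  refine primrec_cons (primrec_rule (primrec_cons (hF 1) nil) hE) ?_
  refine primrec_cons (primrec_rule (primrec_cons hE nil) (hF 1)) ?_
  refine primrec_cons (primrec_rule (primrec_cons (hF 2) nil) hL) ?_
  refine primrec_cons (primrec_rule (primrec_cons hL nil) (hF 2)) ?_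
  refine primrec_cons (primrec_rule (primrec_cons (hF 3) (primrec_cons
    (primrec_atomF ha he) nil)) (primrec_atomF hb he)) ?_
  refine primrec_cons (primrec_cons ((hF 3).pair (Primrec.const true)) (primrec_cons
    ((primrec_atomF ha he).pair (Primrec.const true)) nil')) ?_
  refine primrec_cons (primrec_rule (primrec_cons (primrec_atomF hb he) nil) (hF 3)) ?_
  refine primrec_cons (primrec_rule (primrec_cons hall nil)
    (primrec_atomF ha (primrec_snoc he hc))) ?_
  refine primrec_cons (primrec_rule (primrec_cons (primrec_atomF ha (primrec_snoc he
    (primrec_tag 4 (primrec_pair ha (Primrec.encode.comp he))))) nil) hall) (Primrec.const [])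

theorem satClause_rule (w : ℕ → Bool) (hyps : List ℕ) (concl : ℕ) :
    SatClause w (rule hyps concl) ↔ ((∀ a ∈ hyps, w a = true) → w concl = true) := by
  unfold SatClause rule
  simp only [List.exists_mem_cons_iff, List.mem_map, exists_exists_and_eq_and]
  constructor
  · rintro (h | ⟨a, ha, h⟩) h'
    · exact h
    · rw [h' a ha] at h
      cases h
  · intro h
    by_cases h' : ∀ a ∈ hyps, w a = true
    · exact Or.inl (h h')
    · push Not at h'
      obtain ⟨a, ha, hwa⟩ := h'
      exact Or.inr ⟨a, ha, by simpa using hwa⟩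

/-- The laws of equality and Tarski's truth conditions for a truth assignment to the atoms. -/
structure TruthConditions (W : ℕ → Prop) : Prop where
  refl : ∀ a, W (atomE a a)
  symm : ∀ a b, W (atomE a b) → W (atomE b a)
  trans : ∀ a b c, W (atomE a b) → W (atomE b c) → W (atomE a c)
  succ : ∀ a b, W (atomE a b) → W (atomE (herb.succ a) (herb.succ b))
  add : ∀ a b c d, W (atomE a b) → W (atomE c d) → W (atomE (herb.add a c) (herb.add b d))
  mul : ∀ a b c d, W (atomE a b) → W (atomE c d) → W (atomE (herb.mul a c) (herb.mul b d))
  le : ∀ a b c d, W (atomE a b) → W (atomE c d) → W (atomL a c) → W (atomL b d)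
  bot : ∀ e, ¬ W (atomF (Nat.pair 0 0) e)
  eq_iff : ∀ a b e,
    W (atomF (Nat.pair 1 (Nat.pair a b)) e) ↔ W (atomE (herb.val a e) (herb.val b e))
  le_iff : ∀ a b e,
    W (atomF (Nat.pair 2 (Nat.pair a b)) e) ↔ W (atomL (herb.val a e) (herb.val b e))
  imp_iff : ∀ a b e, W (atomF (Nat.pair 3 (Nat.pair a b)) e) ↔ (W (atomF a e) → W (atomF b e))
  all_elim : ∀ a c e, W (atomF (Nat.pair 4 a) e) → W (atomF a (e ++ [c]))
  all_intro : ∀ a e, W (atomF a (e ++ [henkin a e])) → W (atomF (Nat.pair 4 a) e)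

theorem satClause_logicClauses_iff (w : ℕ → Bool) :
    (∀ p, ∀ c ∈ logicClauses p, SatClause w c) ↔ TruthConditions fun a => w a = true := by
  have h₁ : ∀ a, SatClause w [(a, false)] ↔ ¬ w a = true := by simp [SatClause]
  have h₂ : ∀ a b, SatClause w [(a, true), (b, true)] ↔ w a = true ∨ w b = true := by
    simp [SatClause]
  simp only [Prod.forall, logicClauses, List.forall_mem_cons, satClause_rule, h₁, h₂,
    List.not_mem_nil, false_imp_iff, implies_true, and_true, true_imp_iff, and_imp]
  constructor
  · intro h
    refine ⟨fun a => (h a a a a []).1, fun a b => (h a b a a []).2.1,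
      fun a b c => (h a b c a []).2.2.1, fun a b => (h a b a a []).2.2.2.1,
      fun a b c d => (h a b c d []).2.2.2.2.1, fun a b c d => (h a b c d []).2.2.2.2.2.1,
      fun a b c d => (h a b c d []).2.2.2.2.2.2.1, fun e => (h 0 0 0 0 e).2.2.2.2.2.2.2.1, ?_, ?_,
      ?_, ?_, ?_⟩
    · intro a b e
      obtain ⟨-, -, -, -, -, -, -, -, h, h', -⟩ := h a b 0 0 e
      exact ⟨h, h'⟩
    · intro a b e
      obtain ⟨-, -, -, -, -, -, -, -, -, -, h, h', -⟩ := h a b 0 0 e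
      exact ⟨h, h'⟩
    · intro a b e
      obtain ⟨-, -, -, -, -, -, -, -, -, -, -, -, h, h', h'', -⟩ := h a b 0 0 e
      exact ⟨h, fun hi => h'.elim id fun ha => h'' (hi ha)⟩
    · intro a c e
      obtain ⟨-, -, -, -, -, -, -, -, -, -, -, -, -, -, -, h, -⟩ := h a 0 c 0 e
      exact h
    · intro a e
      obtain ⟨-, -, -, -, -, -, -, -, -, -, -, -, -, -, -, -, h⟩ := h a 0 0 0 e
      exact h
  · intro H a b c d e
    refine ⟨H.refl a, H.symm a b, H.trans a b c, H.succ a b, H.add a b c d, H.mul a b c d,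
      H.le a b c d, H.bot e, (H.eq_iff a b e).1, (H.eq_iff a b e).2, (H.le_iff a b e).1,
      (H.le_iff a b e).2, (H.imp_iff a b e).1, ?_, fun h => (H.imp_iff a b e).2 fun _ => h,
      H.all_elim a c e, H.all_intro a e⟩
    by_cases h : w (atomF a e) = true
    · exact Or.inr h
    · exact Or.inl ((H.imp_iff a b e).2 fun ha => absurd ha h)

/-- Codes of the numerals as closed terms. -/
def numCode : ℕ → ℕ
  | 0 => herb.zero
  | n + 1 => herb.succ (numCode n)

theorem primrec_numCode : Primrec numCode := by
  refine (Primrec.nat_rec₁ herb.zero (primrec_tag 1 Primrec.snd).to₂).of_eq fun n => ?_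
  induction n with
  | zero => rfl
  | succ n ih => exact congrArg herb.succ ih

theorem ofFn_snoc {A : Type} {k : ℕ} (v : Fin k → A) (x : A) :
    List.ofFn (Fin.snoc v x : Fin (k + 1) → A) = List.ofFn v ++ [x] := by
  rw [List.ofFn_succ_last]
  simp

namespace TruthConditions

variable {W : ℕ → Prop} (H : TruthConditions W)

/-- Equality of codes of closed terms according to `W`. -/
def setoid : Setoid ℕ :=
  ⟨fun a b => W (atomE a b), H.refl, H.symm _ _, H.trans _ _ _⟩

/-- The term model of `W`. -/
def Carrier : Type := Quotient H.setoid

/-- The element denoted by a closed term. -/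
def elem (a : ℕ) : H.Carrier := Quotient.mk H.setoid a

/-- The arithmetical structure on the term model. -/
instance : LA.Structure H.Carrier where
  funMap {_} f := match f with
    | ArithFunc.zero => fun _ => H.elem herb.zero
    | ArithFunc.succ => fun v =>
        Quotient.map (sa := H.setoid) (sb := H.setoid) herb.succ (fun a b => H.succ a b) (v 0)
    | ArithFunc.add => fun v =>
        Quotient.map₂ (sa := H.setoid) (sb := H.setoid) (sc := H.setoid) herb.add
          (fun a b h c d h' => H.add a b c d h h') (v 0) (v 1)
    | ArithFunc.mul => fun v =>
        Quotient.map₂ (sa := H.setoid) (sb := H.setoid) (sc := H.setoid) herb.mul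
          (fun a b h c d h' => H.mul a b c d h h') (v 0) (v 1)
  RelMap {_} r := match r with
    | ArithRel.le => fun v => Quotient.lift₂ (s₁ := H.setoid) (s₂ := H.setoid)
        (fun a b => W (atomL a b)) (fun a c b d h h' => propext
          ⟨H.le a b c d h h', H.le b a d c (H.symm _ _ h) (H.symm _ _ h')⟩) (v 0) (v 1)

instance : Nonempty H.Carrier := ⟨H.elem 0⟩

theorem hom_elem : herb.Hom (algOf H.Carrier) H.elem :=
  ⟨rfl, fun _ => rfl, fun _ _ => rfl, fun _ _ => rfl⟩

theorem elem_numCode (n : ℕ) : H.elem (numCode n) = num n := by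
  induction n with
  | zero => rfl
  | succ n ih =>
    change succM (H.elem (numCode n)) = succM (num n)
    rw [ih]

theorem elem_val {k : ℕ} (t : LA.Term (Empty ⊕ Fin k)) (e : Fin k → ℕ) :
    H.elem (herb.val (termCode t) (List.ofFn e)) = tval t fun i => H.elem (e i) := by
  rw [H.hom_elem.val, List.map_ofFn]
  exact val_termCode t _

theorem elem_eq_elem {a b : ℕ} : H.elem a = H.elem b ↔ W (atomE a b) :=
  Quotient.eq (r := H.setoid)

theorem holds_iff {k : ℕ} (φ : LA.BoundedFormula Empty k) (e : Fin k → ℕ) :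
    Holds φ (fun i => H.elem (e i)) ↔ W (atomF (formCode φ) (List.ofFn e)) := by
  induction φ with
  | falsum => exact iff_of_false id (H.bot _)
  | equal t s =>
    rw [formCode, H.eq_iff, ← H.elem_eq_elem, H.elem_val, H.elem_val]
    rfl
  | rel R ts =>
    cases R
    rw [formCode, H.le_iff, holds_rel, ← H.elem_val, ← H.elem_val]
    rfl
  | imp φ ψ ih₁ ih₂ =>
    rw [formCode, H.imp_iff, ← ih₁, ← ih₂]
    rfl
  | all φ ih =>
    have hsnoc : ∀ c, (Fin.snoc (fun i => H.elem (e i)) (H.elem c) : Fin _ → H.Carrier) =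
        fun i => H.elem ((Fin.snoc e c : Fin _ → ℕ) i) :=
      fun c => (Fin.comp_snoc H.elem e c).symm
    rw [holds_all, formCode]
    constructor
    · intro h
      refine H.all_intro _ _ ?_
      rw [← ofFn_snoc, ← ih, ← hsnoc]
      exact h _
    · intro h x
      induction x using Quotient.ind with | _ c
      change Holds φ (Fin.snoc (fun i => H.elem (e i)) (H.elem c) : Fin _ → H.Carrier)
      rw [hsnoc, ih, ofFn_snoc]
      exact H.all_elim _ _ _ h

end TruthConditions

theorem lt_encode_of_mem {l : List ℕ} {a : ℕ} (h : a ∈ l) : a < Encodable.encode l := by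
  induction l with
  | nil => simp at h
  | cons b l ih =>
    rw [Encodable.encode_list_cons, Encodable.encode_nat, Nat.lt_succ_iff]
    rcases List.mem_cons.1 h with rfl | h
    · exact Nat.left_le_pair _ _
    · exact (ih h).le.trans (Nat.right_le_pair _ _)

theorem lt_pair_of_pos {k : ℕ} (hk : 0 < k) (a : ℕ) : a < Nat.pair k a :=
  lt_of_lt_of_le (Nat.lt_add_of_pos_left hk) (Nat.add_le_pair k a)

section Semantics

variable (M : Type) [LA.Structure M]

/-- One step of the evaluation of formula codes in a structure. -/
def evalStep (a : ℕ) (f : ℕ → List M → Prop) (env : List M) : Prop :=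
  match a.unpair.1, a.unpair.2 with
  | 1, b => (algOf M).val b.unpair.1 env = (algOf M).val b.unpair.2 env
  | 2, b => leM ((algOf M).val b.unpair.1 env) ((algOf M).val b.unpair.2 env)
  | 3, b => f b.unpair.1 env → f b.unpair.2 env
  | 4, b => ∀ x, f b (env ++ [x])
  | _, _ => False

/-- Truth in `M` of the formula with code `a`. -/
def evalF (a : ℕ) (env : List M) : Prop :=
  evalStep M a (fun b env => if b < a then evalF b env else False) env
termination_by a

theorem evalF_bot (env : List M) : ¬ evalF M (Nat.pair 0 0) env := by
  rw [evalF]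
  simp [evalStep]

theorem evalF_eq (a b : ℕ) (env : List M) :
    evalF M (Nat.pair 1 (Nat.pair a b)) env ↔ (algOf M).val a env = (algOf M).val b env := by
  rw [evalF]
  simp [evalStep]

theorem evalF_le (a b : ℕ) (env : List M) :
    evalF M (Nat.pair 2 (Nat.pair a b)) env ↔ leM ((algOf M).val a env) ((algOf M).val b env) := by
  rw [evalF]
  simp [evalStep]

theorem evalF_imp (a b : ℕ) (env : List M) :
    evalF M (Nat.pair 3 (Nat.pair a b)) env ↔ (evalF M a env → evalF M b env) := by
  have h := lt_pair_of_pos (k := 3) (by omega) (Nat.pair a b)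
  have ha := (Nat.left_le_pair a b).trans_lt h
  have hb := (Nat.right_le_pair a b).trans_lt h
  rw [evalF]
  simp [evalStep, ha, hb]

theorem evalF_all (a : ℕ) (env : List M) :
    evalF M (Nat.pair 4 a) env ↔ ∀ x, evalF M a (env ++ [x]) := by
  have ha := lt_pair_of_pos (k := 4) (by omega) a
  rw [evalF]
  simp [evalStep, ha]

theorem evalF_formCode {k : ℕ} (φ : LA.BoundedFormula Empty k) (v : Fin k → M) :
    evalF M (formCode φ) (List.ofFn v) ↔ Holds φ v := by
  induction φ with
  | falsum => exact iff_of_false (evalF_bot M _) id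
  | equal t s =>
    rw [formCode, evalF_eq, val_termCode, val_termCode]
    rfl
  | rel R ts =>
    cases R
    rw [formCode, evalF_le, val_termCode, val_termCode, holds_rel]
  | imp φ ψ ih₁ ih₂ =>
    rw [formCode, evalF_imp, ih₁, ih₂]
    rfl
  | all φ ih =>
    rw [formCode, evalF_all, holds_all]
    refine forall_congr' fun x => ?_
    rw [← ofFn_snoc, ih]

open Classical in
/-- An element refuting the formula with code `a`, if there is one. -/
noncomputable def counterexample (a : ℕ) (env : List M) : M :=
  if h : ∃ x, ¬ evalF M a (env ++ [x]) then h.choose else zeroM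

theorem evalF_all_of_counterexample {a : ℕ} {env : List M}
    (h : evalF M a (env ++ [counterexample M a env])) (x : M) : evalF M a (env ++ [x]) := by
  by_contra hx
  have hex : ∃ x, ¬ evalF M a (env ++ [x]) := ⟨x, hx⟩
  rw [counterexample, dif_pos hex] at h
  exact hex.choose_spec h

/-- One step of the interpretation of closed terms with Henkin constants. -/
noncomputable def interpStep (c : ℕ) (f : ℕ → M) : M :=
  match c.unpair.1, c.unpair.2 with
  | 0, _ => zeroM
  | 1, b => succM (f b)
  | 2, b => addM (f b.unpair.1) (f b.unpair.2)
  | 3, b => mulM (f b.unpair.1) (f b.unpair.2)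
  | _, b => counterexample M b.unpair.1 ((ofCode (List ℕ) b.unpair.2).map f)

/-- The element of `M` denoted by the closed term with code `c`. -/
noncomputable def interp (c : ℕ) : M :=
  interpStep M c fun b => if b < c then interp b else zeroM
termination_by c

theorem hom_interp : herb.Hom (algOf M) (interp M) := by
  refine ⟨?_, fun a => ?_, fun a b => ?_, fun a b => ?_⟩
  · rw [interp]
    simp [interpStep, herb, algOf]
  · have h := lt_pair_of_pos (k := 1) (by omega) a
    rw [interp]
    simp [interpStep, herb, algOf, h]
  · have h := lt_pair_of_pos (k := 2) (by omega) (Nat.pair a b)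
    have ha := (Nat.left_le_pair a b).trans_lt h
    have hb := (Nat.right_le_pair a b).trans_lt h
    rw [interp]
    simp [interpStep, herb, algOf, ha, hb]
  · have h := lt_pair_of_pos (k := 3) (by omega) (Nat.pair a b)
    have ha := (Nat.left_le_pair a b).trans_lt h
    have hb := (Nat.right_le_pair a b).trans_lt h
    rw [interp]
    simp [interpStep, herb, algOf, ha, hb]

theorem interp_henkin (a : ℕ) (e : List ℕ) :
    interp M (henkin a e) = counterexample M a (e.map (interp M)) := by
  have h := lt_pair_of_pos (k := 4) (by omega) (Nat.pair a (Encodable.encode e))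
  have he : ∀ c ∈ e, c < henkin a e := fun c hc =>
    (lt_encode_of_mem hc).trans ((Nat.right_le_pair _ _).trans_lt h)
  have hmap : (e.map fun b => if b < henkin a e then interp M b else zeroM) =
      e.map (interp M) := List.map_congr_left fun c hc => if_pos (he c hc)
  rw [interp, interpStep, hmap.symm]
  simp [henkin, ofCode_encode]

theorem interp_numCode (n : ℕ) : interp M (numCode n) = num n := by
  induction n with
  | zero => exact (hom_interp M).zero
  | succ n ih => exact ((hom_interp M).succ _).trans (congrArg succM ih)

/-- Truth in `M` of the atoms. -/
def atomTruth (a : ℕ) : Prop :=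
  match a.unpair.1, a.unpair.2 with
  | 0, b => interp M b.unpair.1 = interp M b.unpair.2
  | 1, b => leM (interp M b.unpair.1) (interp M b.unpair.2)
  | _, b => evalF M b.unpair.1 ((ofCode (List ℕ) b.unpair.2).map (interp M))

theorem atomTruth_atomE (a b : ℕ) : atomTruth M (atomE a b) ↔ interp M a = interp M b := by
  simp [atomTruth, atomE]

theorem atomTruth_atomL (a b : ℕ) : atomTruth M (atomL a b) ↔ leM (interp M a) (interp M b) := by
  simp [atomTruth, atomL]

theorem atomTruth_atomF (a : ℕ) (e : List ℕ) :
    atomTruth M (atomF a e) ↔ evalF M a (e.map (interp M)) := by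
  simp [atomTruth, atomF, ofCode_encode]

theorem truthConditions_atomTruth : TruthConditions (atomTruth M) := by
  have hom := hom_interp M
  constructor <;> simp only [atomTruth_atomE, atomTruth_atomL, atomTruth_atomF, hom.succ, hom.add,
    hom.mul, hom.val, evalF_eq, evalF_le, evalF_imp, evalF_all, evalF_bot, not_false_eq_true,
    List.map_append, List.map_cons, List.map_nil, implies_true, interp_henkin]
  · exact fun a b h => h.symm
  · exact fun a b c h h' => h.trans h'
  · exact fun a b h => congrArg _ h
  · exact fun a b c d h h' => congrArg₂ _ h h'
  · exact fun a b c d h h' => congrArg₂ _ h h'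
  · intro a b c d h h' hl
    rwa [← h, ← h']
  · exact fun a c e h => h _
  · exact fun a e h => evalF_all_of_counterexample M h

end Semantics

/-- The clauses stating that the axioms of `T` hold, and that the formula with code `x`, at the
numeral of `x`, has truth value `s`. -/
def theoryClauses (T : LA.Theory) (s : Bool) (x : ℕ) (c : List (ℕ × Bool)) : Prop :=
  (∃ p, c ∈ logicClauses p) ∨ (∃ g, g ∈ axiomCodes T ∧ c = [(atomF (parse g) [], true)]) ∨
    c = [(atomF x [numCode x], s)]

theorem satisfiable_theoryClauses_iff (T : LA.Theory) (s : Bool)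
    (ρ : LA.BoundedFormula Empty 1) :
    Satisfiable (theoryClauses T s (formCode ρ)) ↔
      ∃ (M : Type) (_ : LA.Structure M) (_ : Nonempty M), M ⊨ T ∧
        (Holds ρ (fun _ => (num (formCode ρ) : M)) ↔ s = true) := by
  have hsat : ∀ (w : ℕ → Bool) a s, SatClause w [(a, s)] ↔ w a = s := by simp [SatClause]
  constructor
  · rintro ⟨w, hw⟩
    have H : TruthConditions fun a => w a = true :=
      (satClause_logicClauses_iff w).1 fun p c hc => hw c (Or.inl ⟨p, hc⟩)
    refine ⟨H.Carrier, inferInstance, inferInstance, ⟨fun τ hτ => ?_⟩, ?_⟩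
    · have h := hw _ (Or.inr (Or.inl ⟨_, ⟨τ, hτ, rfl⟩, rfl⟩))
      rw [hsat, parse_godel] at h
      have := (H.holds_iff τ default).2 (by rwa [List.ofFn_zero])
      unfold Sentence.Realize Formula.Realize
      unfold Holds at this
      convert this
    · have h := hw _ (Or.inr (Or.inr rfl))
      rw [hsat] at h
      have h' := H.holds_iff ρ fun _ => numCode (formCode ρ)
      rw [H.elem_numCode] at h'
      rw [h', ← h]
      rfl
  · rintro ⟨M, _, _, hM, hρ⟩
    classical
    refine ⟨fun a => decide (atomTruth M a), ?_⟩
    rintro c (⟨p, hc⟩ | ⟨_, ⟨τ, hτ, rfl⟩, rfl⟩ | rfl)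
    · refine (satClause_logicClauses_iff _).2 ?_ p c hc
      simpa using truthConditions_atomTruth M
    · rw [hsat, parse_godel, decide_eq_true_iff, atomTruth_atomF]
      have := (evalF_formCode M τ default).2
        (by
          have h := hM.realize_of_mem τ hτ
          unfold Sentence.Realize Formula.Realize at h
          unfold Holds
          convert h)
      rwa [List.ofFn_zero] at this
    · rw [hsat]
      have := evalF_formCode M ρ fun _ => num (formCode ρ)
      rw [hρ] at this
      have h' : atomTruth M (atomF (formCode ρ) [numCode (formCode ρ)]) ↔ s = true := by
        rw [atomTruth_atomF, ← this, ← interp_numCode]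
        rfl
      cases s <;> simpa using h'

theorem SD.theoryClauses {n : ℕ} {T : LA.Theory} (hT : PiDefinable n (axiomCodes T)) (s : Bool) :
    SD (n + 1) fun v : Fin 2 → ℕ =>
      theoryClauses T s (v 0) (ofCode (List (ℕ × Bool)) (v 1)) := by
  obtain ⟨Ψ, hΨ, hdef⟩ := hT
  have hax : SD (n + 1) fun v : Fin 1 → ℕ => v 0 ∈ axiomCodes T := by
    refine hΨ.sd.not.congr fun v => ?_
    rw [not_not, hdef, show ![v 0] = v from List.ofFn_inj.1 rfl]
    unfold Holds
    rfl
  have hc : Primrec fun p : ℕ × ℕ × ℕ => ofCode (List (ℕ × Bool)) p.2.1 :=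
    primrec_ofCode.comp (Primrec.fst.comp Primrec.snd)
  have nil : Primrec fun _ : ℕ × ℕ × ℕ => ([] : List (ℕ × Bool)) := Primrec.const []
  have h₁ : PrimrecPred fun p : ℕ × ℕ × ℕ => ofCode (List (ℕ × Bool)) p.2.1 ∈
      logicClauses (ofCode (ℕ × ℕ × ℕ × ℕ × List ℕ) p.1) := by
    have h : PrimrecRel fun (x y : List (ℕ × Bool)) => x = y := Primrec.eq
    refine ((PrimrecRel.exists_mem_list h).comp
      (primrec_logicClauses.comp (primrec_ofCode.comp Primrec.fst)) hc).of_eq fun p => ?_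
    simp
  have h₂ : PrimrecPred fun p : ℕ × ℕ × ℕ => ofCode (List (ℕ × Bool)) p.2.1 =
      [(atomF (parse p.1) [], true)] :=
    Primrec.eq.comp hc (primrec_cons ((primrec_atomF (primrec_parse.comp Primrec.fst)
      (Primrec.const [])).pair (Primrec.const true)) nil)
  have h₃ : PrimrecPred fun p : ℕ × ℕ × ℕ => ofCode (List (ℕ × Bool)) p.2.1 =
      [(atomF p.1 [numCode p.1], s)] :=
    Primrec.eq.comp hc (primrec_cons ((primrec_atomF Primrec.fst (primrec_cons
      (primrec_numCode.comp Primrec.fst) (Primrec.const []))).pair (Primrec.const s)) nil)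
  refine SD.congr (R := fun v => (∃ q, ofCode (List (ℕ × Bool)) (v 1) ∈
      logicClauses (ofCode (ℕ × ℕ × ℕ × ℕ × List ℕ) q)) ∨
    (∃ g, g ∈ axiomCodes T ∧ ofCode (List (ℕ × Bool)) (v 1) = [(atomF (parse g) [], true)]) ∨
    ofCode (List (ℕ × Bool)) (v 1) = [(atomF (v 0) [numCode (v 0)], s)]) ?_ fun v => ?_
  · have hn := Nat.le_add_left 1 n
    refine (SD.exists ?_).or ((SD.exists (SD.and ?_ ?_)).or ?_)
    · exact (SD.of_primrec h₁ 2 1 1).mono hn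
    · exact hax.proj ![2]
    · exact (SD.of_primrec h₂ 2 1 1).mono hn
    · exact (SD.of_primrec h₃ 0 1 1).mono hn
  · refine or_congr ⟨?_, ?_⟩ Iff.rfl
    · rintro ⟨p, h⟩
      exact ⟨Encodable.encode p, by rwa [ofCode_encode]⟩
    · rintro ⟨q, h⟩
      exact ⟨_, h⟩

/-- **Corollary 2.6.** No `n`-consistent and `Πₙ`-definable extension of `Q`
is `Π_{n+1}`-deciding. -/
theorem nconsistent_piDefinable_not_piSuccDeciding (n : ℕ) (T : LA.Theory)
    (hQ : ExtendsQ T) (hcon : NCon n T)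
    (hdef : PiDefinable n (axiomCodes T)) :
    ∃ γ : LA.Sentence, IsPi (n + 1) γ ∧ ¬ Proves T γ ∧ ¬ Proves T (∼γ) := by
  have key : ∀ (ρ : LA.BoundedFormula Empty 1) (s : Bool) (φ : LA.BoundedFormula Empty 1),
      (∀ (M : Type) [LA.Structure M] (v : Fin 1 → M), Holds φ v ↔ ¬ (Holds ρ v ↔ s = true)) →
      (¬ Satisfiable (theoryClauses T s (formCode ρ)) ↔ Entails T φ ![formCode ρ]) := by
    intro ρ s φ hφ
    rw [satisfiable_theoryClauses_iff]
    simp only [not_exists, not_and]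
    refine forall_congr' fun M => forall_congr' fun _ => forall_congr' fun _ =>
      forall_congr' fun _ => ?_
    have hv : (fun i => num (![formCode ρ] i) : Fin 1 → M) = fun _ => num (formCode ρ) := by
      funext i
      rw [Subsingleton.elim i 0]
      rfl
    rw [hφ, hv]
  refine exists_undecided hQ hcon
    (A := fun v => ¬ Satisfiable (theoryClauses T false (v 0)))
    (B := fun v => ¬ Satisfiable (theoryClauses T true (v 0)))
    (SD.not_satisfiable (K := fun v => theoryClauses T false (v 0)) (SD.theoryClauses hdef false))
    (SD.not_satisfiable (K := fun v => theoryClauses T true (v 0)) (SD.theoryClauses hdef true))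
    (fun ρ => ![formCode ρ]) (fun ρ => key ρ false ρ ?_) (fun ρ => key ρ true (∼ρ) ?_)
  · intro M _ v
    simp
  · intro M _ v
    simp

end GRNonRE
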